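/- arXiv:2501.09920 — 5 statements merged into one kernel-verified Lean document; each statement's English description precedes it below -/
import Mathlib

section
/- For every n ≥ 1, the ℚ-dimension of the submodule {f ∈ Λ : f is antisymmetric and harmonic} equals n² − n + 1. (This is the total multiplicity of the sign character in the triagonal fermionic coinvariant ring R_n^{(0,3)}, computed in the isomorphic space of triagonal fermionic harmonics.) -/
noncomputable section

open ExteriorAlgebra

/-- The underlying vector space: `Fin 3 × Fin n → ℚ`, with standard basis `e (j,i)`. -/
abbrev V (n : ℕ) : Type := (Fin 3 × Fin n) → ℚ

/-- Standard basis vector `e_{(j,i)}`. -/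
def e (n : ℕ) (j : Fin 3) (i : Fin n) : V n := Pi.single (j, i) 1

/-- The exterior algebra `Λ` on three sets of `n` anticommuting variables. -/
abbrev Lam (n : ℕ) : Type := ExteriorAlgebra ℚ (V n)

/-- The variable `θ_i`. -/
def θ (n : ℕ) (i : Fin n) : Lam n := ExteriorAlgebra.ι ℚ (e n 0 i)

/-- The variable `ξ_i`. -/
def ξ (n : ℕ) (i : Fin n) : Lam n := ExteriorAlgebra.ι ℚ (e n 1 i)

/-- The variable `ρ_i`. -/
def ρ (n : ℕ) (i : Fin n) : Lam n := ExteriorAlgebra.ι ℚ (e n 2 i)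

/-- The algebra automorphism `A_σ` of `Λ` induced functorially by the linear automorphism
of `V` sending `e_{(j,i)}` to `e_{(j,σ(i))}`. -/
def A (n : ℕ) (σ : Equiv.Perm (Fin n)) : Lam n →ₐ[ℚ] Lam n :=
  ExteriorAlgebra.map (LinearMap.funLeft ℚ ℚ (fun p => (p.1, σ⁻¹ p.2)))

/-- `f ∈ Λ` is antisymmetric if `A_σ f = sgn(σ) • f` for every permutation `σ`. -/
def IsAntisymmetric (n : ℕ) (f : Lam n) : Prop :=
  ∀ σ : Equiv.Perm (Fin n), A n σ f = ((Equiv.Perm.sign σ : ℤ) : ℚ) • f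

/-- The contraction operator `∂_{θ_i}` (left contraction with the dual basis
functional of `e_{(0,i)}`). -/
def dθ (n : ℕ) (i : Fin n) : Module.End ℚ (Lam n) :=
  CliffordAlgebra.contractLeft (LinearMap.proj ((0 : Fin 3), i))

/-- The contraction operator `∂_{ξ_i}` (left contraction with the dual basis
functional of `e_{(1,i)}`). -/
def dξ (n : ℕ) (i : Fin n) : Module.End ℚ (Lam n) :=
  CliffordAlgebra.contractLeft (LinearMap.proj ((1 : Fin 3), i))

/-- The contraction operator `∂_{ρ_i}` (left contraction with the dual basis
functional of `e_{(2,i)}`). -/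
def dρ (n : ℕ) (i : Fin n) : Module.End ℚ (Lam n) :=
  CliffordAlgebra.contractLeft (LinearMap.proj ((2 : Fin 3), i))

/-- The differential operator `Σ_{i=1}^n ∂_{θ_i}^h ∘ ∂_{ξ_i}^k ∘ ∂_{ρ_i}^ℓ`. -/
def D (n : ℕ) (h k l : ℕ) : Module.End ℚ (Lam n) :=
  ∑ i : Fin n, (dθ n i) ^ h * (dξ n i) ^ k * (dρ n i) ^ l

/-- `f ∈ Λ` is harmonic if `Σ_{i=1}^n ∂_{θ_i}^h ∂_{ξ_i}^k ∂_{ρ_i}^ℓ f = 0` for every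
`(h,k,ℓ) ∈ {0,1}³` with `h + k + ℓ > 0`. -/
def IsHarmonic (n : ℕ) (f : Lam n) : Prop :=
  ∀ h k l : ℕ, h ≤ 1 → k ≤ 1 → l ≤ 1 → 0 < h + k + l → D n h k l f = 0

/-- The antisymmetric harmonic elements of `Λ` form a ℚ-submodule. -/
def AH (n : ℕ) : Submodule ℚ (Lam n) where
  carrier := { f | IsAntisymmetric n f ∧ IsHarmonic n f }
  add_mem' := by
    rintro a b ⟨ha1, ha2⟩ ⟨hb1, hb2⟩
    refine ⟨fun σ => ?_, fun h k l h1 h2 h3 h4 => ?_⟩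
    · simp [map_add, ha1 σ, hb1 σ, smul_add]
    · simp [map_add, ha2 h k l h1 h2 h3 h4, hb2 h k l h1 h2 h3 h4]
  zero_mem' := ⟨fun σ => by simp, fun h k l _ _ _ _ => by simp⟩
  smul_mem' := by
    rintro c x ⟨hx1, hx2⟩
    refine ⟨fun σ => ?_, fun h k l h1 h2 h3 h4 => ?_⟩
    · rw [map_smul, hx1 σ, smul_comm]
    · rw [map_smul, hx2 h k l h1 h2 h3 h4, smul_zero]

namespace FermionicHarmonics

variable {n : ℕ}

/-- The additive group underlying `Lam n`. -/
def Lm (n : ℕ) : Type := Lam n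

instance : AddCommGroup (Lm n) := inferInstanceAs (AddCommGroup (Lam n))

instance : Module ℚ (Lm n) := inferInstanceAs (Module ℚ (Lam n))

/-- Contraction with the coordinate functional indexed by `p`. -/
def d (p : Fin 3 × Fin n) : Module.End ℚ (Lm n) :=
  (CliffordAlgebra.contractLeft (LinearMap.proj p) : Module.End ℚ (Lam n))

/-- Left multiplication by the variable indexed by `p`. -/
def m (p : Fin 3 × Fin n) : Module.End ℚ (Lm n) :=
  (LinearMap.mulLeft ℚ (ι ℚ (e n p.1 p.2)) : Module.End ℚ (Lam n))

/-- The constant term. -/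
def ε : Lm n →ₗ[ℚ] ℚ :=
  ((algebraMapInv (R := ℚ) (M := V n)).toLinearMap : Lam n →ₗ[ℚ] ℚ)

/-- The unit of the exterior algebra. -/
def one (n : ℕ) : Lm n := (1 : Lam n)

lemma d_mul_d (p q : Fin 3 × Fin n) : d p * d q = -(d q * d p) :=
  LinearMap.ext fun x => CliffordAlgebra.contractLeft_comm (Q := 0) _ _ (x : Lam n)

lemma d_mul_self (p : Fin 3 × Fin n) : d p * d p = 0 :=
  LinearMap.ext fun x => CliffordAlgebra.contractLeft_contractLeft (Q := 0) _ (x : Lam n)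

lemma m_mul_m (p q : Fin 3 × Fin n) : m p * m q = -(m q * m p) := by
  refine LinearMap.ext fun (x : Lam n) => ?_
  have h := eq_neg_of_add_eq_zero_left (ι_add_mul_swap (R := ℚ) (e n p.1 p.2) (e n q.1 q.2))
  have : ι ℚ (e n p.1 p.2) * (ι ℚ (e n q.1 q.2) * x) =
      -(ι ℚ (e n q.1 q.2) * (ι ℚ (e n p.1 p.2) * x)) := by
    rw [← mul_assoc, h, neg_mul, mul_assoc]
  exact this

lemma m_mul_self (p : Fin 3 × Fin n) : m p * m p = 0 := by
  refine LinearMap.ext fun (x : Lam n) => ?_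
  have : ι ℚ (e n p.1 p.2) * (ι ℚ (e n p.1 p.2) * x) = 0 := by
    rw [← mul_assoc, ι_sq_zero, zero_mul]
  exact this

lemma d_mul_m (p q : Fin 3 × Fin n) :
    d p * m q = (if p = q then 1 else 0) - m q * d p := by
  refine LinearMap.ext fun x => ?_
  have h : d p (m q x) = e n q.1 q.2 p • x - m q (d p x) := 
    CliffordAlgebra.contractLeft_ι_mul (Q := 0) _ _ _
  rw [Module.End.mul_apply, h]
  by_cases hpq : p = q
  · subst hpq; simp [e]
  · simp [e, hpq]

lemma d_mul_m_self (p : Fin 3 × Fin n) : d p * m p = 1 - m p * d p := by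
  simp [d_mul_m]

lemma d_mul_m_of_ne {p q : Fin 3 × Fin n} (h : p ≠ q) : d p * m q = -(m q * d p) := by
  simp [d_mul_m, h]

lemma d_one (p : Fin 3 × Fin n) : d p (one n) = 0 :=
  CliffordAlgebra.contractLeft_one (Q := 0) _

lemma ε_m (p : Fin 3 × Fin n) (x : Lm n) : ε (m p x) = 0 := by
  have h (y : Lam n) : algebraMapInv (ι ℚ (e n p.1 p.2) * y) = 0 := by simp [algebraMapInv]
  exact h x

lemma ε_one : ε (one n) = 1 := map_one (algebraMapInv (R := ℚ) (M := V n))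

/-- The action of a permutation, as a linear map. -/
def act (σ : Equiv.Perm (Fin n)) : Module.End ℚ (Lm n) :=
  ((A n σ).toLinearMap : Module.End ℚ (Lam n))

lemma funLeft_e (σ : Equiv.Perm (Fin n)) (k : Fin 3) (i : Fin n) :
    LinearMap.funLeft ℚ ℚ (fun p : Fin 3 × Fin n => (p.1, σ⁻¹ p.2)) (e n k i) = e n k (σ i) := by
  ext ⟨a, b⟩
  simp [LinearMap.funLeft_apply, e, Pi.single_apply, Equiv.symm_apply_eq]

lemma A_ι_e (σ : Equiv.Perm (Fin n)) (k : Fin 3) (i : Fin n) :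
    A n σ (ι ℚ (e n k i)) = ι ℚ (e n k (σ i)) := by
  rw [A, map_apply_ι, funLeft_e]

lemma act_mul_m (σ : Equiv.Perm (Fin n)) (k : Fin 3) (i : Fin n) :
    act σ * m (k, i) = m (k, σ i) * act σ := by
  refine LinearMap.ext fun (x : Lam n) => ?_
  have : A n σ (ι ℚ (e n k i) * x) = ι ℚ (e n k (σ i)) * A n σ x := by
    rw [map_mul, A_ι_e]
  exact this

lemma act_one (σ : Equiv.Perm (Fin n)) : act σ (one n) = one n := map_one (A n σ)

lemma Lm_induction {P : Lm n → Prop} (h_one : P (one n)) (h_add : ∀ x y, P x → P y → P (x + y))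
    (h_smul : ∀ (r : ℚ) x, P x → P (r • x)) (h_m : ∀ p x, P x → P (m p x)) (x : Lm n) : P x := by
  have h_zero : P 0 := by simpa using h_smul 0 _ h_one
  induction x using CliffordAlgebra.left_induction with
  | algebraMap r =>
    have h : (algebraMap ℚ (Lam n) r : Lam n) = r • (1 : Lam n) := Algebra.algebraMap_eq_smul_one r
    change P (algebraMap ℚ (Lam n) r : Lam n)
    rw [h]
    exact h_smul r _ h_one
  | add x y hx hy => exact h_add _ _ hx hy
  | ι_mul y v hy =>
    have hv : v = ∑ p : Fin 3 × Fin n, v p • e n p.1 p.2 := by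
      ext q
      simp [e, Finset.sum_apply, Pi.single_apply]
    have h : ι ℚ v * (y : Lam n) =
        ∑ p : Fin 3 × Fin n, v p • (ι ℚ (e n p.1 p.2) * (y : Lam n)) := by
      conv_lhs => rw [hv]
      simp [Finset.sum_mul]
    change P (ι ℚ v * (y : Lam n) : Lam n)
    rw [h]
    exact Finset.sum_induction (M := Lm n) _ P h_add h_zero
      fun p _ => h_smul _ _ (h_m p _ hy)

lemma act_mul_d (σ : Equiv.Perm (Fin n)) (k : Fin 3) (i : Fin n) :
    act σ * d (k, i) = d (k, σ i) * act σ := by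
  refine LinearMap.ext fun x => ?_
  induction x using Lm_induction with
  | h_one => simp [act_one, d_one]
  | h_add x y hx hy => rw [map_add, map_add, hx, hy]
  | h_smul r x hx => rw [map_smul, map_smul, hx]
  | h_m p x hx =>
    obtain ⟨l, j⟩ := p
    simp only [← Module.End.mul_apply] at hx ⊢
    rw [mul_assoc, d_mul_m, mul_assoc, act_mul_m, ← mul_assoc (d (k, σ i)), d_mul_m, mul_sub,
      ← mul_assoc, act_mul_m, sub_mul, LinearMap.sub_apply, LinearMap.sub_apply, mul_assoc,
      mul_assoc, Module.End.mul_apply (m _), hx]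
    by_cases h : k = l ∧ i = j
    · simp [h]
    · simp [h]

lemma ε_act (σ : Equiv.Perm (Fin n)) (x : Lm n) : ε (act σ x) = ε x := by
  have h : (algebraMapInv (R := ℚ) (M := V n)).comp (A n σ) = algebraMapInv := by
    ext v
    simp [A, algebraMapInv]
  exact congrArg (fun g : Lam n →ₐ[ℚ] ℚ => g x) h

/-- Equality up to sign. -/
def SEq {M : Type*} [Neg M] (x y : M) : Prop := x = y ∨ x = -y

lemma SEq.refl {M : Type*} [Neg M] (x : M) : SEq x x := Or.inl rfl

lemma SEq.symm {M : Type*} [InvolutiveNeg M] {x y : M} (h : SEq x y) : SEq y x := by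
  rcases h with rfl | rfl
  · exact Or.inl rfl
  · exact Or.inr (neg_neg _).symm

lemma SEq.trans {M : Type*} [InvolutiveNeg M] {x y z : M} (h : SEq x y) (h' : SEq y z) :
    SEq x z := by
  rcases h with rfl | rfl <;> rcases h' with rfl | rfl <;> simp [SEq]

lemma SEq.mul_left {M : Type*} [Mul M] [HasDistribNeg M] {x y : M} (h : SEq x y) (z : M) :
    SEq (z * x) (z * y) := by
  rcases h with rfl | rfl <;> simp [SEq]

lemma SEq.mul_right {M : Type*} [Mul M] [HasDistribNeg M] {x y : M} (h : SEq x y) (z : M) :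
    SEq (x * z) (y * z) := by
  rcases h with rfl | rfl <;> simp [SEq]

lemma SEq.eq_zero_iff {M : Type*} [AddGroup M] {x y : M} (h : SEq x y) : x = 0 ↔ y = 0 := by
  rcases h with rfl | rfl <;> simp

lemma SEq.ε_apply {x y : Module.End ℚ (Lm n)} (h : SEq x y) (f : Lm n) :
    SEq (ε (x f)) (ε (y f)) := by
  rcases h with rfl | rfl <;> simp [SEq]

/-- The composite of the contractions in a list. -/
def dProd (l : List (Fin 3 × Fin n)) : Module.End ℚ (Lm n) := (l.map d).prod

@[simp] lemma dProd_nil : dProd ([] : List (Fin 3 × Fin n)) = 1 := rfl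

@[simp] lemma dProd_cons (p : Fin 3 × Fin n) (l) : dProd (p :: l) = d p * dProd l := by
  simp [dProd]

@[simp] lemma dProd_append (l l' : List (Fin 3 × Fin n)) :
    dProd (l ++ l') = dProd l * dProd l' := by
  simp [dProd]

lemma dProd_perm {l l' : List (Fin 3 × Fin n)} (h : l.Perm l') : SEq (dProd l) (dProd l') := by
  induction h with
  | nil => exact SEq.refl _
  | cons p _ ih => simpa using ih.mul_left (d p)
  | swap p q l =>
    right
    simp only [dProd_cons, ← mul_assoc]
    rw [d_mul_d q p, neg_mul]
  | trans _ _ h h' => exact h.trans h'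

/-- An element annihilated by all contractions is a constant. -/
lemma eq_algebraMap_of_d_eq_zero (x : Lm n) (hx : ∀ p, d p x = 0) :
    ∃ r : ℚ, x = r • one n := by
  let N (p : Fin 3 × Fin n) : Module.End ℚ (Lm n) := d p * m p
  have hNm {p q : Fin 3 × Fin n} (hpq : p ≠ q) : N p * m q = m q * N p := by
    simp only [N]
    rw [mul_assoc, m_mul_m, mul_neg, ← mul_assoc, d_mul_m_of_ne hpq, neg_mul, neg_neg, mul_assoc]
  have hcomm (q) (l : List (Fin 3 × Fin n)) (h : q ∉ l) :
      (l.map N).prod * m q = m q * (l.map N).prod := by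
    induction l with
    | nil => simp
    | cons p l ih =>
      simp only [List.mem_cons, not_or] at h
      rw [List.map_cons, List.prod_cons, mul_assoc, ih h.2, ← mul_assoc, hNm (Ne.symm h.1),
        mul_assoc]
  have hzero (q) (l : List (Fin 3 × Fin n)) (h : q ∈ l) : (l.map N).prod * m q = 0 := by
    induction l with
    | nil => simp at h
    | cons p l ih =>
      rw [List.map_cons, List.prod_cons, mul_assoc]
      by_cases hq : q ∈ l
      · rw [ih hq, mul_zero]
      · obtain rfl : q = p := by simpa [hq] using h
        rw [hcomm q l hq, ← mul_assoc]
        simp only [N]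
        rw [mul_assoc (d q), m_mul_self, mul_zero, zero_mul]
  let l := (Finset.univ : Finset (Fin 3 × Fin n)).toList
  have hfix : (l.map N).prod x = x := by
    generalize l = l
    induction l with
    | nil => simp
    | cons p l ih =>
      rw [List.map_cons, List.prod_cons, Module.End.mul_apply, ih]
      simp [N, d_mul_m_self, hx]
  have hone (y : Lm n) : ∃ r : ℚ, (l.map N).prod y = r • one n := by
    induction y using Lm_induction with
    | h_one =>
      refine ⟨1, ?_⟩
      rw [one_smul]
      generalize l = l
      induction l with
      | nil => simp
      | cons p l ih =>
        rw [List.map_cons, List.prod_cons, Module.End.mul_apply, ih]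
        simp [N, d_mul_m_self, d_one]
    | h_add x y hx hy =>
      obtain ⟨r, hr⟩ := hx
      obtain ⟨s, hs⟩ := hy
      exact ⟨r + s, by rw [map_add, hr, hs, add_smul]⟩
    | h_smul s x hx =>
      obtain ⟨r, hr⟩ := hx
      exact ⟨s * r, by rw [map_smul, hr, mul_smul]⟩
    | h_m p y _ =>
      refine ⟨0, ?_⟩
      rw [← Module.End.mul_apply, hzero p l (by simp [l]), LinearMap.zero_apply, zero_smul]
  rw [← hfix]
  exact hone x

/-- An element is determined by the constant terms of its iterated contractions. -/
lemma eq_zero_of_forall_dProd (x : Lm n) (hx : ∀ l, ε (dProd l x) = 0) : x = 0 := by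
  suffices h : ∀ S : Finset (Fin 3 × Fin n), ∀ x : Lm n, (∀ p ∉ S, d p x = 0) →
      (∀ l, ε (dProd l x) = 0) → x = 0 from h Finset.univ x (by simp) hx
  intro S
  induction S using Finset.induction_on with
  | empty =>
    intro x h0 h
    obtain ⟨r, rfl⟩ := eq_algebraMap_of_d_eq_zero x (fun p => h0 p (by simp))
    have := h []
    simp only [dProd_nil, Module.End.one_apply] at this
    have hr : r = 0 := by simpa [ε_one] using this
    simp [hr]
  | insert p S _ ih =>
    intro x h0 h
    have hd : d p x = 0 := by
      refine ih _ (fun q hq => ?_) (fun l => ?_)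
      · rw [← Module.End.mul_apply]
        by_cases hqp : q = p
        · subst hqp; rw [d_mul_self, LinearMap.zero_apply]
        · rw [d_mul_d, LinearMap.neg_apply, Module.End.mul_apply, h0 q (by simp [hqp, hq]),
            map_zero, neg_zero]
      · have := h (l ++ [p])
        simpa using this
    refine ih x (fun q hq => ?_) h
    by_cases hqp : q = p
    · rw [hqp, hd]
    · exact h0 q (by simp [hqp, hq])

lemma dProd_eq_zero_of_not_nodup {l : List (Fin 3 × Fin n)} (h : ¬ l.Nodup) : dProd l = 0 := by
  induction l with
  | nil => simp at h
  | cons p l ih =>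
    by_cases hl : l.Nodup
    · have hp : p ∈ l := by simpa [hl] using h
      refine (dProd_perm ((List.perm_cons_erase hp).cons p)).eq_zero_iff.2 ?_
      rw [dProd_cons, dProd_cons, ← mul_assoc, d_mul_self, zero_mul]
    · rw [dProd_cons, ih hl, mul_zero]

lemma dProd_mul_dProd (l l' : List (Fin 3 × Fin n)) :
    dProd l * dProd l' = (-1 : ℚ) ^ (l.length * l'.length) • (dProd l' * dProd l) := by
  have h (p : Fin 3 × Fin n) : dProd l * d p = (-1 : ℚ) ^ l.length • (d p * dProd l) := by
    induction l with
    | nil => simp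
    | cons q l ih =>
      rw [dProd_cons, mul_assoc, ih, mul_smul_comm, ← mul_assoc, d_mul_d q p, List.length_cons,
        pow_succ, neg_mul, mul_assoc]
      simp
  induction l' with
  | nil => simp
  | cons p l' ih =>
    rw [dProd_cons, ← mul_assoc, h, smul_mul_assoc, mul_assoc, ih, mul_smul_comm, smul_smul,
      List.length_cons, mul_add, mul_one, pow_add, mul_assoc, mul_comm]

lemma act_mul_dProd (σ : Equiv.Perm (Fin n)) (l : List (Fin 3 × Fin n)) :
    act σ * dProd l = dProd (l.map fun p => (p.1, σ p.2)) * act σ := by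
  induction l with
  | nil => simp
  | cons p l ih =>
    rw [List.map_cons, dProd_cons, dProd_cons, ← mul_assoc, act_mul_d, mul_assoc, ih, mul_assoc]

/-- The composite of the contractions at the position `i` with letters in `t`. -/
def dL (t : List (Fin 3)) (i : Fin n) : Module.End ℚ (Lm n) := dProd (t.map fun k => (k, i))

lemma act_mul_dL (σ : Equiv.Perm (Fin n)) (t : List (Fin 3)) (i : Fin n) :
    act σ * dL t i = dL t (σ i) * act σ := by
  rw [dL, act_mul_dProd, List.map_map]; rfl

@[simp] lemma dL_nil (i : Fin n) : dL [] i = 1 := rfl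

@[simp] lemma dL_cons (k : Fin 3) (t : List (Fin 3)) (i : Fin n) :
    dL (k :: t) i = d (k, i) * dL t i := by
  simp [dL]

/-- The set of variables recorded by a content function. -/
def supp (c : Fin n → Finset (Fin 3)) : Finset (Fin 3 × Fin n) :=
  Finset.univ.filter fun p => p.1 ∈ c p.2

@[simp] lemma mem_supp {c : Fin n → Finset (Fin 3)} {p : Fin 3 × Fin n} :
    p ∈ supp c ↔ p.1 ∈ c p.2 := by
  simp [supp]

/-- The composite of all contractions recorded by a content function. -/
def Op (c : Fin n → Finset (Fin 3)) : Module.End ℚ (Lm n) := dProd (supp c).toList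

/-- The coefficient (up to sign) recorded by a content function. -/
def F (c : Fin n → Finset (Fin 3)) (f : Lm n) : ℚ := ε (Op c f)

lemma dProd_sEq_Op {l : List (Fin 3 × Fin n)} (hl : l.Nodup) (c : Fin n → Finset (Fin 3))
    (h : ∀ p, p ∈ l ↔ p.1 ∈ c p.2) : SEq (dProd l) (Op c) := by
  refine dProd_perm ((List.perm_ext_iff_of_nodup hl (Finset.nodup_toList _)).2 fun p => ?_)
  rw [h, Finset.mem_toList, mem_supp]

lemma Op_mul_dL {c c' : Fin n → Finset (Fin 3)} {t : List (Fin 3)} (ht : t.Nodup) {i : Fin n}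
    (hd : Disjoint t.toFinset (c i)) (hi : c' i = c i ∪ t.toFinset)
    (h : ∀ q, q ≠ i → c' q = c q) : SEq (Op c * dL t i) (Op c') := by
  rw [Op, dL, ← dProd_append]
  refine dProd_sEq_Op ?_ _ fun ⟨k, q⟩ => ?_
  · refine List.Nodup.append (Finset.nodup_toList _) (ht.map fun a b h => by simpa using h) ?_
    rintro ⟨k, q⟩ h1 h2
    rw [Finset.mem_toList, mem_supp] at h1
    simp only [List.mem_map, Prod.mk.injEq] at h2
    obtain ⟨a, ha, rfl, rfl⟩ := h2
    exact Finset.disjoint_left.1 hd (by simpa using ha) h1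
  · rw [List.mem_append, Finset.mem_toList, mem_supp]
    by_cases hq : q = i
    · subst hq; simp [hi]
    · simp [h q hq, Ne.symm hq]

lemma Op_mul_dL_eq_zero {c : Fin n → Finset (Fin 3)} {t : List (Fin 3)} {i : Fin n}
    (hd : ¬ Disjoint t.toFinset (c i)) : Op c * dL t i = 0 := by
  rw [Op, dL, ← dProd_append]
  refine dProd_eq_zero_of_not_nodup fun h => hd ?_
  rw [List.nodup_append'] at h
  refine Finset.disjoint_left.2 fun k hk hk' => ?_
  refine h.2.2 (?_ : (k, i) ∈ _) ?_
  · simpa using hk'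
  · simpa using hk

lemma Op_mul_d {c c' : Fin n → Finset (Fin 3)} {k : Fin 3} {i : Fin n}
    (hd : k ∉ c i) (hi : c' i = insert k (c i)) (h : ∀ q, q ≠ i → c' q = c q) :
    SEq (Op c * d (k, i)) (Op c') := by
  have := Op_mul_dL (c := c) (c' := c') (t := [k]) (by simp) (i := i) (by simpa using hd)
    (by simpa [Finset.union_comm] using hi) h
  simpa using this

lemma Op_mul_d_eq_zero {c : Fin n → Finset (Fin 3)} {k : Fin 3} {i : Fin n}
    (hd : k ∈ c i) : Op c * d (k, i) = 0 := by
  have := Op_mul_dL_eq_zero (c := c) (t := [k]) (i := i) (by simpa using hd)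
  simpa using this

lemma act_mul_Op (σ : Equiv.Perm (Fin n)) (c : Fin n → Finset (Fin 3)) :
    SEq (act σ * Op c) (Op (c ∘ σ.symm) * act σ) := by
  rw [Op, act_mul_dProd]
  refine (dProd_sEq_Op ((Finset.nodup_toList _).map fun p q h => ?_) _ fun p => ?_).mul_right _
  · simpa [Prod.ext_iff] using h
  · simp only [List.mem_map, Finset.mem_toList, mem_supp]
    constructor
    · rintro ⟨q, hq, rfl⟩
      simpa using hq
    · intro h
      exact ⟨(p.1, σ.symm p.2), h, by simp⟩

/-- Antisymmetry, phrased with `act`. -/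
def IsAnti (f : Lm n) : Prop := ∀ σ, act σ f = ((Equiv.Perm.sign σ : ℤ) : ℚ) • f

/-- Harmonicity, phrased with arbitrary words of contractions. -/
def IsHarm (f : Lm n) : Prop := ∀ t : List (Fin 3), t ≠ [] → ∑ i, dL t i f = 0

lemma F_comp_perm {f : Lm n} (hf : IsAnti f) (σ : Equiv.Perm (Fin n))
    (c : Fin n → Finset (Fin 3)) : F (c ∘ σ) f = 0 ↔ F c f = 0 := by
  have h := (act_mul_Op σ (c ∘ σ)).ε_apply f
  rw [Module.End.mul_apply, ε_act, Module.End.mul_apply, hf σ, map_smul, map_smul] at h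
  have hc : (c ∘ σ) ∘ σ.symm = c := by ext; simp
  rw [hc] at h
  rw [F, h.eq_zero_iff, F]
  simp

lemma act_swap_mul_Op {c : Fin n → Finset (Fin 3)} {i j : Fin n} (hij : i ≠ j) (h : c i = c j) :
    act (Equiv.swap i j) * Op c = (-1 : ℚ) ^ (c i).card • (Op c * act (Equiv.swap i j)) := by
  set t := (c i).toList with ht
  set c₀ : Fin n → Finset (Fin 3) := Function.update (Function.update c i ∅) j ∅ with hc₀
  have hW : SEq (Op c₀ * dL t i * dL t j) (Op c) := by
    refine ((Op_mul_dL (c' := Function.update c j ∅) (Finset.nodup_toList _) ?_ ?_ ?_).mul_right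
      _).trans (Op_mul_dL (Finset.nodup_toList _) ?_ ?_ ?_)
    · simp [hc₀, hij]
    · simp [hc₀, hij]
    · intro q hq
      by_cases hqj : q = j
      · subst hqj; simp [hc₀]
      · simp [hc₀, hq, hqj]
    · simp
    · simp [h]
    · intro q hq; simp [hq]
  have h₀ : act (Equiv.swap i j) * Op c₀ = Op c₀ * act (Equiv.swap i j) := by
    rw [Op, act_mul_dProd]
    congr 2
    conv_rhs => rw [← List.map_id (supp c₀).toList]
    refine List.map_congr_left fun p hp => ?_
    rw [Finset.mem_toList, mem_supp] at hp
    have hi : p.2 ≠ i := by rintro rfl; simp [hc₀, hij] at hp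
    have hj : p.2 ≠ j := by rintro rfl; simp [hc₀] at hp
    simp [Equiv.swap_apply_of_ne_of_ne hi hj]
  have hlen : (-1 : ℚ) ^ ((t.map fun k => (k, j)).length * (t.map fun k => (k, i)).length) =
      (-1) ^ (c i).card := by
    simp [ht, pow_mul]
    rcases Nat.even_or_odd (c i).card with h | h <;> simp [h.neg_one_pow]
  have hW' : act (Equiv.swap i j) * (Op c₀ * dL t i * dL t j) =
      (-1 : ℚ) ^ (c i).card • (Op c₀ * dL t i * dL t j * act (Equiv.swap i j)) := by
    rw [← mul_assoc, ← mul_assoc, h₀, mul_assoc (Op c₀), act_mul_dL, Equiv.swap_apply_left,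
      mul_assoc, mul_assoc (dL t j), act_mul_dL, Equiv.swap_apply_right, ← mul_assoc (dL t j)]
    conv_lhs => rw [dL, dL, dProd_mul_dProd, hlen]
    rw [← dL, ← dL]
    simp [mul_assoc]
  rcases hW with hW | hW
  · rw [← hW, hW']
  · have : Op c = -(Op c₀ * dL t i * dL t j) := by rw [hW, neg_neg]
    rw [this, mul_neg, hW', neg_mul, smul_neg]

lemma IsAnti.swap {f : Lm n} (hf : IsAnti f) {i j : Fin n} (hij : i ≠ j) :
    act (Equiv.swap i j) f = -f := by
  rw [hf, Equiv.Perm.sign_swap hij]; simp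

lemma F_eq_zero_of_even {f : Lm n} (hf : IsAnti f) {c : Fin n → Finset (Fin 3)} {i j : Fin n}
    (hij : i ≠ j) (h : c i = c j) (hc : Even (c i).card) : F c f = 0 := by
  have h1 := congrArg (fun g : Module.End ℚ (Lm n) => ε (g f)) (act_swap_mul_Op hij h)
  simp only [hc.neg_one_pow, one_smul, Module.End.mul_apply, ε_act, hf.swap hij, map_neg] at h1
  rw [F]; linarith

/-- A family of operators indexed by positions and compatible with permutations. -/
def Equivariant (x : Fin n → Module.End ℚ (Lm n)) : Prop :=
  ∀ σ i, act σ * x i = x (σ i) * act σ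

lemma ε_block {f : Lm n} (hf : IsAnti f) {W : Module.End ℚ (Lm n)} {i j : Fin n} (hij : i ≠ j)
    (hW : act (Equiv.swap i j) * W = -(W * act (Equiv.swap i j)))
    {x : Fin n → Module.End ℚ (Lm n)} (hx : Equivariant x) :
    ε (W (x i f)) = ε (W (x j f)) := by
  rw [← ε_act (Equiv.swap i j), ← Module.End.mul_apply (act _), hW, LinearMap.neg_apply,
    Module.End.mul_apply, ← Module.End.mul_apply (act _), hx, Module.End.mul_apply,
    hf.swap hij, Equiv.swap_apply_left]
  simp

lemma ε_Op_block {f : Lm n} (hf : IsAnti f) {c : Fin n → Finset (Fin 3)} {i j : Fin n}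
    (h : c i = c j) (hc : (c i).card = 1)
    {x : Fin n → Module.End ℚ (Lm n)} (hx : Equivariant x) :
    ε (Op c (x i f)) = ε (Op c (x j f)) := by
  by_cases hij : i = j
  · rw [hij]
  · refine ε_block hf hij ?_ hx
    rw [act_swap_mul_Op hij h, hc]; simp

lemma F_eq_zero_of_key {f : Lm n} (hf : IsAnti f) (hh : IsHarm f) (c : Fin n → Finset (Fin 3))
    (j : Fin n) (T : Finset (Fin 3)) (hT : T.Nonempty) (hTc : T ⊆ c j)
    (h : ∀ i, i ≠ j → Disjoint T (c i) → (c i = c j \ T ∧ (c i).card = 1) ∨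
      ∀ c' : Fin n → Finset (Fin 3), c' i = c i ∪ T → c' j = c j \ T →
        (∀ q, q ≠ i → q ≠ j → c' q = c q) → F c' f = 0) : F c f = 0 := by
  set c₀ := Function.update c j (c j \ T) with hc₀
  have htT : T.toList.toFinset = T := by simp
  have hj : SEq (ε (Op c₀ (dL T.toList j f))) (F c f) := by
    refine (Op_mul_dL (c := c₀) (c' := c) (Finset.nodup_toList T) (i := j) ?_ ?_ ?_).ε_apply f
    · rw [htT]; simpa [hc₀] using Finset.disjoint_sdiff
    · rw [htT]; simp [hc₀, hTc]
    · intro q hq; simp [hc₀, hq]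
  have hterm (i) : ε (Op c₀ (dL T.toList i f)) = 0 ∨
      ε (Op c₀ (dL T.toList i f)) = ε (Op c₀ (dL T.toList j f)) := by
    by_cases hij : i = j
    · right; rw [hij]
    have hi : c₀ i = c i := by simp [hc₀, hij]
    by_cases hd : Disjoint T (c i)
    · rcases h i hij hd with h | h
      · right
        refine ε_Op_block hf ?_ ?_ fun σ q => act_mul_dL σ _ q
        · rw [hi, h.1]; simp [hc₀]
        · rw [hi, h.2]
      · left
        have := (Op_mul_dL (c := c₀) (c' := Function.update c₀ i (c₀ i ∪ T))
          (Finset.nodup_toList T) (i := i) (by rwa [htT, hi]) (by simp)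
          (fun q hq => by simp [hq])).ε_apply f
        refine this.eq_zero_iff.2 (h _ ?_ ?_ ?_)
        · simp [hi]
        · simp [Ne.symm hij, hc₀]
        · intro q hq hqj; simp [hq, hc₀, hqj]
    · left
      rw [← Module.End.mul_apply, Op_mul_dL_eq_zero (by rwa [htT, hi])]
      simp
  have hsum : ∑ i, ε (Op c₀ (dL T.toList i f)) = 0 := by
    rw [← map_sum, ← map_sum, hh _ (by simpa using hT.ne_empty), map_zero, map_zero]
  rw [← hj.eq_zero_iff]
  by_contra hne
  have h2 : ∑ i, ε (Op c₀ (dL T.toList i f)) =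
      ((Finset.univ.filter fun i => ε (Op c₀ (dL T.toList i f)) ≠ 0).card : ℚ) *
        ε (Op c₀ (dL T.toList j f)) := by
    rw [← Finset.sum_filter_ne_zero, Finset.sum_congr rfl fun i hi =>
      (hterm i).resolve_left (Finset.mem_filter.1 hi).2, Finset.sum_const, nsmul_eq_mul]
  rw [hsum, eq_comm, mul_eq_zero, or_iff_left hne, Nat.cast_eq_zero, Finset.card_eq_zero] at h2
  exact Finset.eq_empty_iff_forall_notMem.1 h2 j (by simpa using hne)

/-- The polarization operator replacing a letter `l` by the letter `k`. -/
def E (k l : Fin 3) : Module.End ℚ (Lm n) := ∑ q, m (k, q) * d (l, q)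

lemma act_mul_E (σ : Equiv.Perm (Fin n)) (k l : Fin 3) : act σ * E k l = E k l * act σ := by
  rw [E, Finset.mul_sum, Finset.sum_mul, ← Equiv.sum_comp σ fun q => m (k, q) * d (l, q) * act σ]
  refine Finset.sum_congr rfl fun q _ => ?_
  rw [← mul_assoc, act_mul_m, mul_assoc, act_mul_d, mul_assoc]

lemma d_mul_E (a k l : Fin 3) (i : Fin n) :
    d (a, i) * E k l = E k l * d (a, i) + if a = k then d (l, i) else 0 := by
  have h (q : Fin n) : d (a, i) * (m (k, q) * d (l, q)) = m (k, q) * d (l, q) * d (a, i) +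
      if q = i then (if a = k then d (l, i) else 0) else 0 := by
    rw [← mul_assoc, d_mul_m, sub_mul, mul_assoc, d_mul_d, mul_neg, sub_neg_eq_add, mul_assoc,
      add_comm]
    congr 1
    by_cases hq : q = i
    · subst hq; by_cases hk : a = k <;> simp [hk]
    · simp [hq, Ne.symm hq]
  rw [E, Finset.mul_sum, Finset.sum_mul, Finset.sum_congr rfl fun q _ => h q,
    Finset.sum_add_distrib]
  simp

lemma dL_mul_E (k l : Fin 3) (t : List (Fin 3)) : ∃ L : List (List (Fin 3)),
    (∀ t' ∈ L, t'.length = t.length) ∧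
    ∀ i : Fin n, dL t i * E k l = E k l * dL t i + (L.map fun t' => dL t' i).sum := by
  induction t with
  | nil => exact ⟨[], by simp, by simp⟩
  | cons a t ih =>
    obtain ⟨L, hL, h⟩ := ih
    refine ⟨(if a = k then [l :: t] else []) ++ L.map (a :: ·), ?_, fun i => ?_⟩
    · intro t' ht'
      rw [List.mem_append] at ht'
      rcases ht' with ht' | ht'
      · split_ifs at ht' <;> simp_all
      · simp only [List.mem_map] at ht'
        obtain ⟨s, hs, rfl⟩ := ht'
        simp [hL s hs]
    · rw [dL_cons, mul_assoc, h, mul_add, ← mul_assoc, d_mul_E, add_mul, ← List.sum_map_mul_left,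
        mul_assoc, add_assoc]
      split_ifs <;> simp [Function.comp_def]

lemma IsAnti.E {f : Lm n} (hf : IsAnti f) (k l : Fin 3) : IsAnti (E k l f) := by
  intro σ
  rw [← Module.End.mul_apply, act_mul_E, Module.End.mul_apply, hf, map_smul]

lemma sum_dL_E_eq_zero {f : Lm n} {N : ℕ}
    (hf : ∀ t : List (Fin 3), t.length = N → ∑ i, dL t i f = 0) (k l : Fin 3)
    {t : List (Fin 3)} (ht : t.length = N) : ∑ i, dL t i (E k l f) = 0 := by
  obtain ⟨L, hL, h⟩ := dL_mul_E (n := n) k l t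
  simp only [← Module.End.mul_apply, h]
  simp only [LinearMap.add_apply, Finset.sum_add_distrib, Module.End.mul_apply]
  rw [← map_sum, hf t ht, map_zero, zero_add]
  clear h
  induction L with
  | nil => simp
  | cons s L ih =>
    simp only [List.map_cons, List.sum_cons, LinearMap.add_apply, Finset.sum_add_distrib]
    rw [ih fun t' ht' => hL t' (by simp [ht']), hf s (by rw [hL s (by simp), ht]), add_zero]

lemma IsHarm.E {f : Lm n} (hf : IsHarm f) (k l : Fin 3) : IsHarm (E k l f) := by
  refine fun t ht => sum_dL_E_eq_zero (fun s hs => hf s ?_) k l rfl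
  rwa [← List.length_pos_iff_ne_nil, hs, List.length_pos_iff_ne_nil]

lemma dProd_mul_m {l : List (Fin 3 × Fin n)} {p : Fin 3 × Fin n} (h : p ∉ l) :
    SEq (dProd l * m p) (m p * dProd l) := by
  induction l with
  | nil => simp [SEq]
  | cons q l ih =>
    simp only [List.mem_cons, not_or] at h
    rw [dProd_cons, mul_assoc]
    refine ((ih h.2).mul_left _).trans (Or.inr ?_)
    rw [← mul_assoc, d_mul_m_of_ne (Ne.symm h.1), neg_mul, mul_assoc]

lemma ε_dProd_m {l : List (Fin 3 × Fin n)} {p : Fin 3 × Fin n} (h : p ∉ l) (f : Lm n) :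
    ε (dProd l (m p f)) = 0 :=
  ((dProd_mul_m h).ε_apply f).eq_zero_iff.2 (ε_m _ _)

lemma ε_Op_m {c : Fin n → Finset (Fin 3)} {k : Fin 3} {i : Fin n} (h : k ∉ c i) (f : Lm n) :
    ε (Op c (m (k, i) f)) = 0 :=
  ε_dProd_m (by simpa using h) f

lemma ε_Op_m_d_eq_zero {c : Fin n → Finset (Fin 3)} {k l : Fin 3} (hkl : k ≠ l) {i : Fin n}
    (h : k ∈ c i → l ∈ c i) (f : Lm n) : ε (Op c (m (k, i) (d (l, i) f))) = 0 := by
  by_cases hk : k ∈ c i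
  · have : m (k, i) * d (l, i) = -(d (l, i) * m (k, i)) := by
      rw [d_mul_m_of_ne (by simpa using hkl.symm), neg_neg]
    rw [← Module.End.mul_apply (m _), this, LinearMap.neg_apply, map_neg, Module.End.mul_apply,
      ← Module.End.mul_apply (Op c), Op_mul_d_eq_zero (h hk)]
    simp
  · exact ε_Op_m hk _

lemma ε_Op_m_d {c c' : Fin n → Finset (Fin 3)} {k l : Fin 3} {i : Fin n} (h : c i = {k})
    (hi : c' i = {l}) (hc : ∀ q, q ≠ i → c' q = c q) (f : Lm n) :
    SEq (ε (Op c (m (k, i) (d (l, i) f)))) (F c' f) := by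
  set c₀ := Function.update c i ∅ with hc₀
  have h1 : SEq (Op c₀ * d (k, i)) (Op c) :=
    Op_mul_d (by simp [hc₀]) (by simp [hc₀, h]) fun q hq => by simp [hc₀, hq]
  have h2 : SEq (Op c₀ * d (l, i)) (Op c') :=
    Op_mul_d (by simp [hc₀]) (by simp [hc₀, hi]) fun q hq => by simp [hc₀, hq, hc q hq]
  refine (h1.symm.ε_apply _).trans (SEq.trans (Or.inl ?_) (h2.ε_apply f))
  rw [Module.End.mul_apply, ← Module.End.mul_apply (d _), d_mul_m_self, LinearMap.sub_apply,
    map_sub, map_sub, Module.End.mul_apply, ε_Op_m (by simp [hc₀])]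
  simp

lemma ε_Op_E (c : Fin n → Finset (Fin 3)) (k l : Fin 3) (f : Lm n) :
    F c (E k l f) = ∑ q, ε (Op c (m (k, q) (d (l, q) f))) := by
  simp [F, E, LinearMap.sum_apply]

lemma F_E_eq_zero {c : Fin n → Finset (Fin 3)} {k l : Fin 3} (hkl : k ≠ l)
    (h : ∀ i, k ∈ c i → l ∈ c i) (f : Lm n) : F c (E k l f) = 0 := by
  rw [ε_Op_E]
  exact Finset.sum_eq_zero fun q _ => ε_Op_m_d_eq_zero hkl (h q) f

lemma equivariant_m_d (k l : Fin 3) : Equivariant fun q : Fin n => m (k, q) * d (l, q) := by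
  intro σ i
  rw [← mul_assoc, act_mul_m, mul_assoc, act_mul_d, mul_assoc]

lemma F_E {f : Lm n} (hf : IsAnti f) {c c' : Fin n → Finset (Fin 3)} {k l : Fin 3} (hkl : k ≠ l)
    (h : ∀ i, k ∈ c i → c i = {k} ∨ l ∈ c i) {j : Fin n} (hj : c j = {k})
    (hj' : c' j = {l}) (hc : ∀ q, q ≠ j → c' q = c q) :
    SEq (F c (E k l f)) ((Finset.univ.filter fun i => c i = {k}).card * F c' f) := by
  have h1 : F c (E k l f) = (Finset.univ.filter fun i => c i = {k}).card *
      ε (Op c (m (k, j) (d (l, j) f))) := by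
    rw [ε_Op_E, ← Finset.sum_filter_add_sum_filter_not _ fun i => c i = {k},
      Finset.sum_congr rfl fun i hi => ?_, Finset.sum_const, nsmul_eq_mul,
      Finset.sum_eq_zero fun i hi => ?_, add_zero]
    · refine ε_Op_m_d_eq_zero hkl (fun hk => (h i hk).resolve_left ?_) f
      simpa using hi
    · have hi' : c i = {k} := by simpa using hi
      exact ε_Op_block hf (x := fun q => m (k, q) * d (l, q)) (hi'.trans hj.symm) (by simp [hi'])
        (equivariant_m_d k l)
  rw [h1]
  rcases ε_Op_m_d hj hj' hc f with h | h <;> rw [h] <;> simp [SEq]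

/-- An element that is both antisymmetric and harmonic. -/
def IsAH (f : Lm n) : Prop := IsAnti f ∧ IsHarm f

lemma IsAH.E {f : Lm n} (hf : IsAH f) (k l : Fin 3) : IsAH (E k l f) := ⟨hf.1.E k l, hf.2.E k l⟩

lemma F_eq_zero_of_F_E {f : Lm n} (hf : IsAnti f) {c c' : Fin n → Finset (Fin 3)} {k l : Fin 3}
    (hkl : k ≠ l) (h : ∀ i, k ∈ c i → c i = {k} ∨ l ∈ c i) {j : Fin n} (hj : c j = {k})
    (hj' : c' j = {l}) (hc : ∀ q, q ≠ j → c' q = c q) (h0 : F c (E k l f) = 0) : F c' f = 0 := by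
  have := (F_E hf hkl h hj hj' hc).eq_zero_iff.1 h0
  refine (mul_eq_zero.1 this).resolve_left ?_
  rw [Nat.cast_eq_zero, Finset.card_eq_zero]
  exact Finset.ne_empty_of_mem (a := j) (by simpa using hj)

/-- Vanishing of a coefficient can be checked after replacing all singletons by `{0}`. -/
lemma F_eq_zero_of_singletons (Q : (Fin n → Finset (Fin 3)) → Prop)
    (hQ : ∀ c j l, Q c → c j = {l} → Q (Function.update c j {0}))
    (hQ' : ∀ c i, Q c → 0 ∈ c i → c i = {0} ∨ c i = Finset.univ)
    (base : ∀ c, Q c → (∀ i, (c i).card = 1 → c i = {0}) → ∀ f, IsAH f → F c f = 0) :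
    ∀ c, Q c → ∀ f, IsAH f → F c f = 0 := by
  suffices h : ∀ (N : ℕ) (c : Fin n → Finset (Fin 3)),
      (Finset.univ.filter fun i => (c i).card = 1 ∧ c i ≠ {0}).card = N → Q c →
      ∀ f, IsAH f → F c f = 0 from fun c => h _ c rfl
  intro N
  induction N with
  | zero =>
    intro c hN hc
    refine base c hc fun i hi => ?_
    by_contra hi'
    exact Finset.eq_empty_iff_forall_notMem.1 (Finset.card_eq_zero.1 hN) i (by simp [hi, hi'])
  | succ N ih =>
    intro c hN hc f hf
    obtain ⟨j, hj⟩ : (Finset.univ.filter fun i => (c i).card = 1 ∧ c i ≠ {0}).Nonempty := by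
      rw [← Finset.card_pos, hN]; omega
    have hj1 := (Finset.mem_filter.1 hj).2.1
    have hj2 := (Finset.mem_filter.1 hj).2.2
    obtain ⟨l, hl⟩ := Finset.card_eq_one.1 hj1
    have hl0 : 0 ≠ l := by rintro rfl; exact hj2 hl
    have hQc := hQ c j l hc hl
    refine F_eq_zero_of_F_E hf.1 (c := Function.update c j {0}) hl0 (fun i hi => ?_) (j := j)
      (by simp) hl (fun q hq => by simp [hq]) (ih _ ?_ hQc _ (hf.E 0 l))
    · rcases hQ' _ i hQc hi with h | h
      · exact Or.inl h
      · right; rw [h]; simp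
    · have : (Finset.univ.filter fun i => (Function.update c j {0} i).card = 1 ∧
          Function.update c j {0} i ≠ {0}) =
          (Finset.univ.filter fun i => (c i).card = 1 ∧ c i ≠ {0}).erase j := by
        ext i
        by_cases hi : i = j
        · subst hi; simp
        · simp [hi]
      rw [this, Finset.card_erase_of_mem hj, hN]; rfl

lemma F_eq_zero_of_empty_empty {f : Lm n} (hf : IsAH f) {c : Fin n → Finset (Fin 3)} {i j : Fin n}
    (hij : i ≠ j) (hi : c i = ∅) (hj : c j = ∅) : F c f = 0 :=
  F_eq_zero_of_even hf.1 hij (hi.trans hj.symm) (by simp [hi])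

lemma F_eq_zero_of_univ {f : Lm n} (hf : IsAH f) {c : Fin n → Finset (Fin 3)}
    (h : ∀ i, c i ≠ ∅) {j : Fin n} (hj : c j = Finset.univ) : F c f = 0 := by
  refine F_eq_zero_of_key hf.1 hf.2 c j Finset.univ Finset.univ_nonempty hj.ge fun i _ hd => ?_
  have key : ∀ s : Finset (Fin 3), Disjoint Finset.univ s → s = ∅ := by decide
  exact absurd (key _ hd) (h i)

lemma F_eq_zero_of_empty_univ_univ {f : Lm n} (hf : IsAH f) {c : Fin n → Finset (Fin 3)}
    {i₀ j j' : Fin n} (hi : c i₀ = ∅) (hj : c j = Finset.univ) (hj' : c j' = Finset.univ)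
    (hjj' : j' ≠ j) : F c f = 0 := by
  by_cases hu : ∃ i, i ≠ i₀ ∧ c i = ∅
  · obtain ⟨i, hi1, hi2⟩ := hu
    exact F_eq_zero_of_empty_empty hf hi1 hi2 hi
  replace hu : ∀ i, i ≠ i₀ → c i ≠ ∅ := fun i hi1 hi2 => hu ⟨i, hi1, hi2⟩
  refine F_eq_zero_of_key hf.1 hf.2 c j {1, 2} (by simp) (by simp [hj]) fun i hij hd => ?_
  have key : ∀ s : Finset (Fin 3), Disjoint {1, 2} s → s = ∅ ∨ s = {0} := by decide
  rcases key _ hd with h | h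
  · right
    intro c' h1 h2 h3
    have hii : i = i₀ := by by_contra hne; exact hu i hne h
    refine F_eq_zero_of_univ hf (fun q => ?_) (j := j') ?_
    · by_cases hqi : q = i
      · rw [hqi, h1, h]; decide
      · by_cases hqj : q = j
        · rw [hqj, h2, hj]; decide
        · rw [h3 q hqi hqj]; exact hu q (hii ▸ hqi)
    · rw [h3 j' ?_ hjj', hj']
      rintro rfl
      rw [h] at hj'
      exact absurd hj' (by decide)
  · left
    rw [h, hj]; decide

lemma F_eq_zero_of_univ_pair {f : Lm n} (hf : IsAH f) {c : Fin n → Finset (Fin 3)}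
    {j j' : Fin n} (hj : c j = Finset.univ) (hj' : (c j').card = 2) :
    F c f = 0 := by
  obtain ⟨k, hk⟩ : ∃ k, c j' = {k}ᶜ := by
    generalize c j' = s at hj'
    revert s; decide
  have hjj' : j' ≠ j := by
    rintro rfl; rw [hj] at hj'; revert hj'; decide
  refine F_eq_zero_of_key hf.1 hf.2 c j {k}ᶜ
    ((by decide : ∀ k : Fin 3, ({k}ᶜ : Finset (Fin 3)).Nonempty) k)
    (by simp [hj]) fun i hij hd => ?_
  have key : ∀ (k : Fin 3) (s : Finset (Fin 3)), Disjoint {k}ᶜ s → s = ∅ ∨ s = {k} := by decide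
  rcases key _ _ hd with h | h
  · right
    intro c' h1 h2 h3
    have hij' : i ≠ j' := by
      rintro rfl
      rw [h] at hj'
      simp at hj'
    have hc' := h3 j' hij'.symm hjj'
    refine F_eq_zero_of_even hf.1 hij' ?_ ?_
    · rw [h1, h, hc', hk]; simp
    · rw [h1, h]
      exact (by decide : ∀ k : Fin 3, Even (∅ ∪ {k}ᶜ : Finset (Fin 3)).card) k
  · left
    rw [h, hj]
    exact ⟨(by decide : ∀ k : Fin 3, {k} = Finset.univ \ {k}ᶜ) k, by simp⟩

lemma F_eq_zero_of_empty_univ_zeros {f : Lm n} (hf : IsAH f) {c : Fin n → Finset (Fin 3)}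
    {i₀ j : Fin n} (hi : c i₀ = ∅) (hj : c j = Finset.univ)
    (h : ∀ q, q ≠ i₀ → q ≠ j → c q = {0}) : F c f = 0 := by
  have hij : i₀ ≠ j := by rintro rfl; rw [hi] at hj; revert hj; decide
  set c₀ : Fin n → Finset (Fin 3) := Function.update c j ∅ with hc₀
  have hc₀i : c₀ i₀ = ∅ := by simp [hc₀, hij, hi]
  have hc₀j : c₀ j = ∅ := by simp [hc₀]
  have hc₀q (q) (h1 : q ≠ i₀) (h2 : q ≠ j) : c₀ q = {0} := by simp [hc₀, h2, h q h1 h2]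
  set a : Fin n → Module.End ℚ (Lm n) := dL [1, 2] with ha
  have had (q r : Fin n) : a q * d (0, r) = d (0, r) * a q := by
    have := dProd_mul_dProd [((1 : Fin 3), q), (2, q)] [((0 : Fin 3), r)]
    simpa [ha] using this
  set Z := ε (Op c₀ (a j (d (0, j) f))) with hZ
  set X := ε (Op c₀ (a j (d (0, i₀) f))) with hX
  set Y := ε (Op c₀ (d (0, i₀) (a i₀ f))) with hY
  have hXZ : X + Z = 0 := by
    have h1 := hf.2 [0] (by simp)
    have h2 := congrArg (fun x => ε (Op c₀ (a j x))) h1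
    simp only [map_sum, map_zero, dL_cons, dL_nil, mul_one] at h2
    rw [← h2, hX, hZ, ← Finset.sum_pair (f := fun q => ε (Op c₀ (a j (d (0, q) f)))) hij]
    refine Finset.sum_subset (Finset.subset_univ _) fun q _ hq => ?_
    simp only [Finset.mem_insert, Finset.mem_singleton, not_or] at hq
    rw [← Module.End.mul_apply (a j), had, Module.End.mul_apply, ← Module.End.mul_apply (Op c₀),
      Op_mul_d_eq_zero (by simp [hc₀q q hq.1 hq.2])]
    simp
  set c₁ : Fin n → Finset (Fin 3) := Function.update c₀ i₀ {0} with hc₁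
  have h₁ : SEq (Op c₀ * d (0, i₀)) (Op c₁) :=
    Op_mul_d (by simp [hc₀i]) (by simp [hc₁, hc₀i]) fun q hq => by simp [hc₁, hq]
  have hXY : X + (n - 1 : ℚ) * Y = 0 := by
    have h1 := hf.2 [1, 2] (by simp)
    have h2 := congrArg (fun x => ε (Op c₀ (d (0, i₀) x))) h1
    simp only [map_sum, map_zero] at h2
    rw [← Finset.add_sum_erase _ _ (Finset.mem_univ j)] at h2
    rw [← h2, hX, ← Module.End.mul_apply (a j), had, Module.End.mul_apply, ← ha]
    congr 1
    rw [Finset.sum_congr rfl (g := fun _ => Y) fun q hq => ?_]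
    · rw [Finset.sum_const, Finset.card_erase_of_mem (Finset.mem_univ _), Finset.card_univ,
        Fintype.card_fin, nsmul_eq_mul, Nat.cast_sub (by have := j.2; omega), Nat.cast_one]
    · have hqj : q ≠ j := (Finset.mem_erase.1 hq).1
      have hblock : ε (Op c₁ (a q f)) = ε (Op c₁ (a i₀ f)) := by
        refine ε_Op_block hf.1 ?_ ?_ fun σ r => act_mul_dL σ _ r
        · by_cases hqi : q = i₀
          · rw [hqi]
          · simp [hc₁, hqi, hc₀q q hqi hqj]
        · by_cases hqi : q = i₀
          · simp [hqi, hc₁]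
          · simp [hc₁, hqi, hc₀q q hqi hqj]
      rw [hY, ← Module.End.mul_apply (Op c₀), ← Module.End.mul_apply (Op c₀)]
      rcases h₁ with h₁ | h₁ <;> rw [h₁] <;> simp [hblock]
  have hZY : Z = -Y := by
    have hsw := act_swap_mul_Op (c := c₀) hij (hc₀i.trans hc₀j.symm)
    rw [hc₀i, Finset.card_empty, pow_zero, one_smul] at hsw
    have h3 : act (Equiv.swap i₀ j) * (Op c₀ * (a j * d (0, j))) =
        Op c₀ * (d (0, i₀) * a i₀) * act (Equiv.swap i₀ j) := by
      rw [← mul_assoc, hsw, mul_assoc, ← mul_assoc (act _), ha, act_mul_dL,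
        Equiv.swap_apply_right, mul_assoc (dL _ _), act_mul_d, Equiv.swap_apply_right,
        ← mul_assoc (dL _ _), ← ha, had, ← mul_assoc]
    have h4 := congrArg (fun g : Module.End ℚ (Lm n) => ε (g f)) h3
    simp only [Module.End.mul_apply, ε_act, hf.1.swap hij, map_neg] at h4
    rw [hZ, h4]
  have hn : (n : ℚ) * Y = 0 := by linear_combination hXY - hXZ + hZY
  have hn0 : (n : ℚ) ≠ 0 := by
    have := j.2
    rw [Nat.cast_ne_zero]; omega
  have hZ0 : Z = 0 := by rw [hZY, (mul_eq_zero.1 hn).resolve_left hn0, neg_zero]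
  have hfin := (Op_mul_dL (c := c₀) (c' := c) (t := [1, 2, 0]) (by decide) (i := j)
    (by simp [hc₀j]) (by rw [hc₀j, hj]; decide) fun q hq => by simp [hc₀, hq]).ε_apply f
  refine hfin.eq_zero_iff.1 ?_
  simpa [hZ, ha] using hZ0

lemma F_eq_zero_of_empty_univ {f : Lm n} (hf : IsAH f) {c : Fin n → Finset (Fin 3)}
    {i₀ j : Fin n} (hi : c i₀ = ∅) (hj : c j = Finset.univ) : F c f = 0 := by
  have hij : i₀ ≠ j := by rintro rfl; rw [hi] at hj; revert hj; decide
  by_cases hs : ∀ q, q ≠ i₀ → q ≠ j → (c q).card = 1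
  · refine F_eq_zero_of_singletons (fun c => c i₀ = ∅ ∧ c j = Finset.univ ∧
      ∀ q, q ≠ i₀ → q ≠ j → (c q).card = 1) ?_ ?_ ?_ c ⟨hi, hj, hs⟩ f hf
    · rintro c r l ⟨h1, h2, h3⟩ hr
      have hri : r ≠ i₀ := by rintro rfl; simp [h1] at hr
      have hrj : r ≠ j := by rintro rfl; rw [h2] at hr; revert l; decide
      refine ⟨by simp [hri.symm, h1], by simp [hrj.symm, h2], fun q hq hq' => ?_⟩
      by_cases hqr : q = r
      · simp [hqr]
      · simp [hqr, h3 q hq hq']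
    · rintro c i ⟨h1, h2, h3⟩ h0
      by_cases hii : i = i₀
      · simp [hii, h1] at h0
      · by_cases hij : i = j
        · right; rw [hij, h2]
        · left
          have := h3 i hii hij
          generalize c i = s at this h0
          revert s; decide
    · rintro c ⟨h1, h2, h3⟩ h4 f hf
      exact F_eq_zero_of_empty_univ_zeros hf h1 h2 fun q hq hq' => h4 q (h3 q hq hq')
  · push Not at hs
    obtain ⟨q, hqi, hqj, hq⟩ := hs
    have key : ∀ s : Finset (Fin 3), s.card ≠ 1 → s = ∅ ∨ s = Finset.univ ∨ s.card = 2 := by decide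
    rcases key _ hq with h | h | h
    · exact F_eq_zero_of_empty_empty hf hqi h hi
    · exact F_eq_zero_of_empty_univ_univ hf hi hj h hqj
    · exact F_eq_zero_of_univ_pair hf hj h

lemma F_eq_zero_of_nonempty (hn : 1 ≤ n) {f : Lm n} (hf : IsAH f) {c : Fin n → Finset (Fin 3)}
    (h : ∀ i, c i ≠ ∅) : F c f = 0 := by
  have key : ∀ s : Finset (Fin 3), s ≠ ∅ → s.card = 1 ∨ s = Finset.univ ∨ s.card = 2 := by decide
  by_cases hs : ∀ q, (c q).card = 1
  · refine F_eq_zero_of_singletons (fun c => ∀ q, (c q).card = 1) ?_ ?_ ?_ c hs f hf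
    · intro c r l h3 _ q
      by_cases hqr : q = r
      · simp [hqr]
      · simp [hqr, h3 q]
    · intro c i h3 h0
      left
      have := h3 i
      generalize c i = s at this h0
      revert s; decide
    · intro c h3 h4 f hf
      have h5 (q) : c q = {0} := h4 q (h3 q)
      refine F_eq_zero_of_key hf.1 hf.2 c ⟨0, hn⟩ {0} (by simp) (by simp [h5]) fun i _ hd => ?_
      rw [h5 i] at hd
      simp at hd
  · push Not at hs
    obtain ⟨j, hj⟩ := hs
    rcases (key _ (h j)).resolve_left hj with hj | hj
    · exact F_eq_zero_of_univ hf h hj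
    · refine F_eq_zero_of_key hf.1 hf.2 c j (c j) (by rw [← Finset.card_pos, hj]; simp) le_rfl
        fun i hij hd => ?_
      right
      intro c' h1 h2 _
      refine F_eq_zero_of_empty_univ hf (i₀ := j) (j := i) (by simpa using h2) ?_
      rw [h1]
      have h3 := h i
      generalize c i = s at hd h3
      generalize c j = s' at hd hj
      revert s s'; decide

lemma F_eq_zero_of_two_pairs (hn : 1 ≤ n) {f : Lm n} (hf : IsAH f) {c : Fin n → Finset (Fin 3)}
    {i₀ j j' : Fin n} (hi : c i₀ = ∅) (hjj' : j ≠ j') (hj : (c j).card = 2)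
    (hj' : (c j').card = 2) : F c f = 0 := by
  by_cases hu : ∃ i, i ≠ i₀ ∧ c i = ∅
  · obtain ⟨i, hi1, hi2⟩ := hu
    exact F_eq_zero_of_empty_empty hf hi1 hi2 hi
  replace hu : ∀ i, i ≠ i₀ → c i ≠ ∅ := fun i hi1 hi2 => hu ⟨i, hi1, hi2⟩
  by_cases hcc : c j = c j'
  · exact F_eq_zero_of_even hf.1 hjj' hcc (by rw [hj]; decide)
  obtain ⟨k, l, m, hjk, hjm, hkl, hkm, hlm⟩ : ∃ k l m, c j = {k, l} ∧ c j' = {k, m} ∧ k ≠ l ∧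
      k ≠ m ∧ l ≠ m := by
    generalize c j = s at *
    generalize c j' = s' at *
    clear hu hjj' hi hf
    revert s s'; decide
  have hsd : ({k, m} : Finset (Fin 3)) \ {k} = {m} := by
    exact (by decide : ∀ k m : Fin 3, k ≠ m → ({k, m} : Finset (Fin 3)) \ {k} = {m}) k m hkm
  refine F_eq_zero_of_key hf.1 hf.2 c j' {k} (by simp) (by simp [hjm]) fun i hij hd => ?_
  have key : ∀ (k l m : Fin 3), k ≠ l ∧ k ≠ m ∧ l ≠ m → ∀ s : Finset (Fin 3), k ∉ s →
    s = ∅ ∨ s = {m} ∨ s = {l} ∨ s ∪ {k} = Finset.univ := by decide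
  have hjj : j ≠ i → j ≠ j' := fun _ => hjj'
  rcases key k l m ⟨hkl, hkm, hlm⟩ _ (by simpa using hd) with h | h | h | h
  · right
    intro c' h1 h2 h3
    have hii : i = i₀ := by by_contra hne; exact hu i hne h
    refine F_eq_zero_of_nonempty hn hf fun q => ?_
    by_cases hqi : q = i
    · rw [hqi, h1, h]; simp
    · by_cases hqj : q = j'
      · rw [hqj, h2, hjm, hsd]; simp
      · rw [h3 q hqi hqj]; exact hu q (hii ▸ hqi)
  · left
    rw [hjm, hsd, h]; simp
  · right
    intro c' h1 h2 h3
    have hji : j ≠ i := by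
      rintro rfl
      rw [h] at hj
      simp at hj
    have h4 := h3 j hji hjj'
    refine F_eq_zero_of_even hf.1 hji ?_ ?_
    · rw [h4, hjk, h1, h, Finset.union_comm]; rfl
    · rw [h4, hj]; decide
  · right
    intro c' h1 h2 h3
    refine F_eq_zero_of_empty_univ hf (i₀ := i₀) (j := i) ?_ (h1.trans h)
    rw [h3 i₀, hi]
    · rintro rfl
      rw [hi] at h
      exact (by decide : ∀ k : Fin 3, (∅ ∪ {k} : Finset (Fin 3)) ≠ Finset.univ) k h
    · rintro rfl
      rw [hi] at hj'
      simp at hj'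

lemma F_eq_zero_of_pair (hn : 1 ≤ n) {f : Lm n} (hf : IsAH f) {c : Fin n → Finset (Fin 3)}
    {i₀ j : Fin n} (hi : c i₀ = ∅) {k l m : Fin 3} (hkl : k ≠ l) (hkm : k ≠ m) (hlm : l ≠ m)
    (hj : c j = {k, l}) (hs : ∀ q, q ≠ i₀ → q ≠ j → (c q).card = 1)
    (h : ∀ i, c i = {m} → ∀ c' : Fin n → Finset (Fin 3), c' i₀ = ∅ → c' j = {l} → c' i = {k, m} →
      (∀ q, q ≠ i₀ → q ≠ i → (c' q).card = 1) → F c' f = 0) : F c f = 0 := by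
  have hij : j ≠ i₀ := by rintro rfl; rw [hi] at hj; exact absurd hj.symm (by simp)
  have hsd : ({k, l} : Finset (Fin 3)) \ {k} = {l} := by
    exact (by decide : ∀ k m : Fin 3, k ≠ m → ({k, m} : Finset (Fin 3)) \ {k} = {m}) k l hkl
  refine F_eq_zero_of_key hf.1 hf.2 c j {k} (by simp) (by simp [hj]) fun i hij hd => ?_
  by_cases hii : i = i₀
  · subst hii
    right
    intro c' h1 h2 h3
    refine F_eq_zero_of_nonempty hn hf fun q => ?_
    by_cases hqi : q = i
    · rw [hqi, h1]; simp
    · by_cases hqj : q = j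
      · rw [hqj, h2, hj, hsd]; simp
      · rw [h3 q hqi hqj]
        intro h
        have := hs q hqi hqj
        simp [h] at this
  · have key : ∀ (k l m : Fin 3), k ≠ l → k ≠ m → l ≠ m → ∀ s : Finset (Fin 3), s.card = 1 → Disjoint {k} s →
      s = {l} ∨ s = {m} := by decide
    rcases key k l m hkl hkm hlm _ (hs i hii hij) hd with h' | h'
    · left
      rw [h', hj, hsd]; simp
    · right
      intro c' h1 h2 h3
      refine h i h' c' ?_ ?_ ?_ fun q hq hq' => ?_
      · rw [h3 i₀ (Ne.symm hii) (Ne.symm ‹j ≠ i₀›), hi]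
      · rw [h2, hj, hsd]
      · rw [h1, h', Finset.union_comm]; rfl
      · by_cases hqj : q = j
        · rw [hqj, h2, hj, hsd]; simp
        · rw [h3 q hq' hqj, hs q hq hqj]

/-- An antisymmetric harmonic element is determined by its coefficients on words with one empty
position, all remaining positions being singletons with the possible exception of one `{1, 2}`,
in which case a `{0}` also occurs. -/
lemma eq_zero_of_F (hn : 1 ≤ n) {f : Lm n} (hf : IsAH f)
    (h1 : ∀ (c : Fin n → Finset (Fin 3)) (i₀ : Fin n), c i₀ = ∅ →
      (∀ q, q ≠ i₀ → (c q).card = 1) → F c f = 0)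
    (h2 : ∀ (c : Fin n → Finset (Fin 3)) (i₀ j j' : Fin n), c i₀ = ∅ → c j = {1, 2} → c j' = {0} →
      (∀ q, q ≠ i₀ → q ≠ j → (c q).card = 1) → F c f = 0) : f = 0 := by
  have hF (c : Fin n → Finset (Fin 3)) : F c f = 0 := by
    by_cases hne : ∀ i, c i ≠ ∅
    · exact F_eq_zero_of_nonempty hn hf hne
    push Not at hne
    obtain ⟨i₀, hi⟩ := hne
    by_cases hs : ∀ q, q ≠ i₀ → (c q).card = 1
    · exact h1 c i₀ hi hs
    push Not at hs
    obtain ⟨j, hji, hj⟩ := hs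
    have key : ∀ s : Finset (Fin 3), s.card ≠ 1 → s = ∅ ∨ s = Finset.univ ∨ s.card = 2 := by decide
    rcases key _ hj with hj | hj | hj
    · exact F_eq_zero_of_empty_empty hf hji hj hi
    · exact F_eq_zero_of_empty_univ hf hi hj
    by_cases hs : ∀ q, q ≠ i₀ → q ≠ j → (c q).card = 1
    · by_cases hj12 : c j = {1, 2}
      · by_cases h0 : ∃ j', c j' = {0}
        · obtain ⟨j', hj'⟩ := h0
          exact h2 c i₀ j j' hi hj12 hj' hs
        · push Not at h0
          exact F_eq_zero_of_pair hn hf hi (k := 1) (l := 2) (m := 0) (by decide) (by decide)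
            (by decide) hj12 hs fun i hi => absurd hi (h0 i)
      · obtain ⟨k, m, hk, hkm, hk0, hm0⟩ : ∃ k m, c j = {k, 0} ∧ ({k, m} : Finset (Fin 3)) = {1, 2}
            ∧ k ≠ 0 ∧ m ≠ 0 := by
          generalize c j = s at *
          clear hs hji hi
          revert s; decide
        have hkm' : k ≠ m := by
          rintro rfl
          clear hk; revert k; decide
        refine F_eq_zero_of_pair hn hf hi hk0 hkm' hm0.symm hk hs fun i _ c' h3 h4 h5 h6 => ?_
        exact h2 c' i₀ i j h3 (h5.trans hkm) h4 h6
    · push Not at hs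
      obtain ⟨j', hji', hjj', hj'⟩ := hs
      rcases key _ hj' with hj' | hj' | hj'
      · exact F_eq_zero_of_empty_empty hf hji' hj' hi
      · exact F_eq_zero_of_empty_univ hf hi hj'
      · exact F_eq_zero_of_two_pairs hn hf hi hjj' hj' hj
  refine eq_zero_of_forall_dProd f fun l => ?_
  by_cases hl : l.Nodup
  · refine ((dProd_sEq_Op hl (fun i => Finset.univ.filter fun k => (k, i) ∈ l) ?_).ε_apply
      f).eq_zero_iff.2 (hF _)
    intro p; simp
  · rw [dProd_eq_zero_of_not_nodup hl]; simp

lemma dL_perm {t t' : List (Fin 3)} (h : t.Perm t') :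
    SEq (dL t : Fin n → Module.End ℚ (Lm n)) (dL t') := by
  induction h with
  | nil => exact SEq.refl _
  | cons k _ ih =>
    rcases ih with ih | ih
    · left; ext1 i; rw [dL_cons, dL_cons, ih]
    · right; ext1 i; rw [dL_cons, ih, Pi.neg_apply, Pi.neg_apply, dL_cons, mul_neg]
  | swap k l t =>
    right
    ext1 i
    rw [Pi.neg_apply]
    simp only [dL_cons, ← mul_assoc]
    rw [d_mul_d (l, i) (k, i), neg_mul]
  | trans _ _ h h' => exact h.trans h'

lemma dL_eq_zero_of_not_nodup {t : List (Fin 3)} (h : ¬ t.Nodup) (i : Fin n) : dL t i = 0 :=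
  dProd_eq_zero_of_not_nodup fun h' => h (List.Nodup.of_map _ h')

/-- The operator `D n h k l` as a sum of words of contractions. -/
lemma D_apply (h k l : ℕ) (f : Lm n) :
    D n h k l (f : Lam n) =
      ∑ i, dL (List.replicate h 0 ++ List.replicate k 1 ++ List.replicate l 2) i f := by
  have h2 (i : Fin n) : dL (List.replicate h 0 ++ List.replicate k 1 ++ List.replicate l 2) i =
      d (0, i) ^ h * d (1, i) ^ k * d (2, i) ^ l := by
    simp [dL, dProd, mul_assoc]
  simp only [h2]
  rw [← LinearMap.sum_apply]
  rfl

lemma isAH_iff {f : Lm n} : IsAH f ↔ (f : Lam n) ∈ AH n := by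
  refine and_congr Iff.rfl ⟨fun hf h k l hh hk hl hpos => ?_, fun hf t ht => ?_⟩
  · rw [D_apply h k l]
    refine hf _ fun h0 => ?_
    simp at h0
    omega
  · by_cases htn : t.Nodup
    · obtain ⟨h, k, l, hh, hk, hl, hp⟩ : ∃ h k l : ℕ, h ≤ 1 ∧ k ≤ 1 ∧ l ≤ 1 ∧
          t.Perm (List.replicate h 0 ++ List.replicate k 1 ++ List.replicate l 2) := by
        refine ⟨t.count 0, t.count 1, t.count 2, List.nodup_iff_count_le_one.1 htn _,
          List.nodup_iff_count_le_one.1 htn _, List.nodup_iff_count_le_one.1 htn _, ?_⟩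
        rw [List.perm_iff_count]
        intro a
        fin_cases a <;> simp [List.count_append, List.count_replicate]
      have h0 := hf h k l hh hk hl (by
        by_contra hc
        obtain ⟨rfl, rfl, rfl⟩ : h = 0 ∧ k = 0 ∧ l = 0 := by omega
        simp at hp
        exact ht hp)
      rw [D_apply h k l] at h0
      rcases dL_perm (n := n) hp with h1 | h1
      · rw [h1]; exact h0
      · rw [h1]
        simp only [Pi.neg_apply, LinearMap.neg_apply, Finset.sum_neg_distrib]
        exact neg_eq_zero.2 h0
    · simp [dL_eq_zero_of_not_nodup htn]

/-- An element annihilated by any two contractions at the same position. -/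
def IsLocal (f : Lm n) : Prop := ∀ (i : Fin n) (k l : Fin 3), d (k, i) (d (l, i) f) = 0

lemma IsLocal.dL {f : Lm n} (hf : IsLocal f) (i : Fin n) {t : List (Fin 3)} (ht : 2 ≤ t.length) :
    dL t i f = 0 := by
  induction t with
  | nil => simp at ht
  | cons a t ih =>
    match t with
    | [] => simp at ht
    | [b] => simpa using hf i a b
    | b :: c :: t => rw [dL_cons, Module.End.mul_apply, ih (by simp), map_zero]

lemma IsLocal.E {f : Lm n} (hf : IsLocal f) (k l : Fin 3) : IsLocal (E k l f) := by
  intro i a b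
  have h : d (a, i) * (d (b, i) * FermionicHarmonics.E k l) =
      FermionicHarmonics.E k l * (d (a, i) * d (b, i)) +
      (if a = k then d (l, i) * d (b, i) else 0) + (if b = k then d (a, i) * d (l, i) else 0) := by
    rw [d_mul_E, mul_add, ← mul_assoc, d_mul_E, add_mul, mul_assoc]
    split_ifs <;> simp
  have h' := congrArg (fun g : Module.End ℚ (Lm n) => g f) h
  simp only [Module.End.mul_apply] at h'
  rw [h', LinearMap.add_apply, LinearMap.add_apply]
  split_ifs <;> simp [hf i]

lemma IsLocal.isHarm {f : Lm n} (hf : IsLocal f) (h : ∀ k, ∑ i, d (k, i) f = 0) : IsHarm f := by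
  intro t ht
  match t with
  | [k] => simpa using h k
  | a :: b :: t => exact Finset.sum_eq_zero fun i _ => hf.dL i (by simp)

/-- The product of all the variables `θ_i`. -/
def vol (n : ℕ) : Lm n := (ιMulti ℚ n fun i => e n 0 i : Lam n)

/-- The composite of the multiplications in a list. -/
def mProd (l : List (Fin 3 × Fin n)) : Module.End ℚ (Lm n) := (l.map m).prod

/-- The variables `θ_i` in order. -/
def zeros (n : ℕ) : List (Fin 3 × Fin n) := (List.finRange n).map fun i => (0, i)

lemma zeros_nodup : (zeros n).Nodup :=
  (List.nodup_finRange n).map fun i j h => by simpa using h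

lemma mem_zeros {p : Fin 3 × Fin n} : p ∈ zeros n ↔ p.1 = 0 := by
  obtain ⟨k, i⟩ := p
  simp [zeros, eq_comm]

lemma vol_eq : vol n = mProd (zeros n) (one n) := by
  have h (l : List (Fin 3 × Fin n)) :
      mProd l (one n) = ((l.map fun p => ι ℚ (e n p.1 p.2)).prod : Lam n) := by
    induction l with
    | nil => rfl
    | cons p l ih =>
      rw [mProd, List.map_cons, List.prod_cons, Module.End.mul_apply, ← mProd, ih, List.map_cons,
        List.prod_cons]
      rfl
  rw [h, vol, ιMulti_apply, zeros, List.map_map, ← List.ofFn_eq_map]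
  rfl

lemma isAnti_vol : IsAnti (vol n) := by
  intro σ
  have h : A n σ (ιMulti ℚ n fun i => e n 0 i) =
      ((Equiv.Perm.sign σ : ℤ) : ℚ) • ιMulti ℚ n fun i => e n 0 i := by
    rw [A, map_apply_ιMulti]
    have h1 := (ιMulti ℚ n (M := V n)).map_perm (fun i => e n 0 i) σ
    have h2 : (LinearMap.funLeft ℚ ℚ fun p : Fin 3 × Fin n => (p.1, σ⁻¹ p.2)) ∘ (fun i => e n 0 i) =
        (fun i => e n 0 i) ∘ σ := by
      ext1 i
      exact funLeft_e σ 0 i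
    rw [h2, h1]
    rcases Int.units_eq_one_or (Equiv.Perm.sign σ) with h | h <;> rw [h] <;> simp
  exact h

lemma d_mProd_one {p : Fin 3 × Fin n} {l : List (Fin 3 × Fin n)} (h : p ∉ l) :
    d p (mProd l (one n)) = 0 := by
  induction l with
  | nil => exact d_one p
  | cons q l ih =>
    simp only [List.mem_cons, not_or] at h
    rw [mProd, List.map_cons, List.prod_cons, Module.End.mul_apply, ← mProd,
      ← Module.End.mul_apply, d_mul_m_of_ne h.1, LinearMap.neg_apply, Module.End.mul_apply, ih h.2]
    simp

lemma dProd_reverse_mProd {l : List (Fin 3 × Fin n)} (h : l.Nodup) :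
    dProd l.reverse (mProd l (one n)) = one n := by
  induction l with
  | nil => rfl
  | cons p l ih =>
    rw [List.nodup_cons] at h
    rw [List.reverse_cons, dProd_append, dProd_cons, dProd_nil, mul_one, mProd, List.map_cons,
      List.prod_cons, Module.End.mul_apply, Module.End.mul_apply, ← mProd,
      ← Module.End.mul_apply (d p), d_mul_m_self, LinearMap.sub_apply, Module.End.mul_apply,
      d_mProd_one h.1, map_zero, sub_zero, Module.End.one_apply, ih h.2]

lemma F_vol {c : Fin n → Finset (Fin 3)} (h : ∀ i, c i = {0}) : F c (vol n) ≠ 0 := by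
  have h1 : SEq (dProd (zeros n).reverse) (Op c) := by
    refine dProd_sEq_Op (List.nodup_reverse.2 zeros_nodup) c fun p => ?_
    rw [List.mem_reverse, mem_zeros, h, Finset.mem_singleton]
  have h2 := (h1.ε_apply (vol n)).eq_zero_iff
  rw [vol_eq, dProd_reverse_mProd zeros_nodup, ε_one, ← vol_eq] at h2
  exact fun h3 => one_ne_zero (h2.2 h3)

lemma d_vol {p : Fin 3 × Fin n} (h : p.1 ≠ 0) : d p (vol n) = 0 := by
  rw [vol_eq]
  exact d_mProd_one (by rwa [mem_zeros])

/-- The sum of all contractions with a given letter. -/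
def Dsum (k : Fin 3) : Module.End ℚ (Lm n) := ∑ i, d (k, i)

lemma d_mul_Dsum (p : Fin 3 × Fin n) (k : Fin 3) : d p * Dsum k = -(Dsum k * d p) := by
  rw [Dsum, Finset.mul_sum, Finset.sum_mul, ← Finset.sum_neg_distrib]
  exact Finset.sum_congr rfl fun i _ => d_mul_d _ _

/-- The image of the volume element under the sum of the contractions `∂_{θ_i}`. -/
def vand (n : ℕ) : Lm n := Dsum 0 (vol n)

lemma d_vand {p : Fin 3 × Fin n} (h : p.1 ≠ 0) : d p (vand n) = 0 := by
  rw [vand, ← Module.End.mul_apply, d_mul_Dsum, LinearMap.neg_apply, Module.End.mul_apply, d_vol h]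
  simp

lemma isAnti_vand : IsAnti (vand n) := by
  intro σ
  have h : act σ * Dsum 0 = Dsum 0 * act σ := by
    rw [Dsum, Finset.mul_sum, Finset.sum_mul,
      ← Equiv.sum_comp σ fun q => d ((0 : Fin 3), q) * act σ]
    exact Finset.sum_congr rfl fun q _ => act_mul_d _ _ _
  rw [vand, ← Module.End.mul_apply, h, Module.End.mul_apply, isAnti_vol, map_smul]

lemma isLocal_vand : IsLocal (vand n) := by
  intro i k l
  by_cases hl : l = 0
  · by_cases hk : k = 0
    · rw [hl, hk, ← Module.End.mul_apply, d_mul_self, LinearMap.zero_apply]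
    · rw [← Module.End.mul_apply, d_mul_d, LinearMap.neg_apply, Module.End.mul_apply,
        d_vand (p := (k, i)) hk]
      simp
  · rw [d_vand (p := (l, i)) hl, map_zero]

lemma isAH_vand : IsAH (vand n) := by
  refine ⟨isAnti_vand, isLocal_vand.isHarm fun k => ?_⟩
  by_cases hk : k = 0
  · have h : Dsum 0 * Dsum 0 = -(Dsum 0 * Dsum 0 : Module.End ℚ (Lm n)) := by
      conv_lhs => rw [Dsum, Finset.sum_mul]
      conv_rhs => rw [Dsum, Finset.mul_sum, ← Finset.sum_neg_distrib]
      exact Finset.sum_congr rfl fun i _ => d_mul_Dsum _ _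
    have h' : Dsum 0 * Dsum 0 = (0 : Module.End ℚ (Lm n)) := by
      have h2 : (2 : ℚ) • (Dsum 0 * Dsum 0 : Module.End ℚ (Lm n)) = 0 := by
        rw [two_smul]
        exact add_eq_zero_iff_eq_neg.2 h
      exact (smul_eq_zero.1 h2).resolve_left two_ne_zero
    rw [hk, ← LinearMap.sum_apply, ← Dsum, vand, ← Module.End.mul_apply, h', LinearMap.zero_apply]
  · exact Finset.sum_eq_zero fun i _ => d_vand hk

lemma F_vand_eq_zero {c : Fin n → Finset (Fin 3)} {i : Fin n} {k : Fin 3} (hk : k ≠ 0)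
    (hi : k ∈ c i) : F c (vand n) = 0 := by
  have h := (Op_mul_d (c := Function.update c i ((c i).erase k)) (c' := c) (k := k) (i := i)
    (by simp) (by simp [Finset.insert_erase hi]) (fun q hq => by simp [hq])).ε_apply (vand n)
  refine h.eq_zero_iff.1 ?_
  rw [Module.End.mul_apply, d_vand hk]
  simp

lemma F_vand_ne_zero {c : Fin n → Finset (Fin 3)} {i₀ : Fin n} (hi : c i₀ = ∅)
    (h : ∀ i, i ≠ i₀ → c i = {0}) : F c (vand n) ≠ 0 := by
  have h1 : F c (vand n) = ε (Op c (d (0, i₀) (vol n))) := by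
    rw [F, vand, Dsum, LinearMap.sum_apply, map_sum, map_sum]
    refine Finset.sum_eq_single i₀ (fun i _ hii => ?_) (by simp)
    rw [← Module.End.mul_apply, Op_mul_d_eq_zero (by simp [h i hii])]
    simp
  have h2 := (Op_mul_d (c := c) (c' := fun _ => {0}) (k := 0) (i := i₀) (by simp [hi])
    (by simp [hi]) (fun q hq => by simp [h q hq])).ε_apply (vol n)
  rw [h1]
  exact fun h3 => F_vol (fun _ => rfl) (h2.eq_zero_iff.1 h3)

/-- The number of positions with a given content. -/
def cnt (c : Fin n → Finset (Fin 3)) (s : Finset (Fin 3)) : ℕ :=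
  (Finset.univ.filter fun i => c i = s).card

lemma cnt_pos {c : Fin n → Finset (Fin 3)} {i : Fin n} {s : Finset (Fin 3)} (h : c i = s) :
    0 < cnt c s :=
  Finset.card_pos.2 ⟨i, by simpa using h⟩

lemma exists_of_cnt_ne_zero {c : Fin n → Finset (Fin 3)} {s : Finset (Fin 3)} (h : cnt c s ≠ 0) :
    ∃ i, c i = s := by
  obtain ⟨i, hi⟩ := Finset.card_pos.1 (Nat.pos_of_ne_zero h)
  exact ⟨i, by simpa using hi⟩

lemma cnt_update_add {c : Fin n → Finset (Fin 3)} {j : Fin n} {s u : Finset (Fin 3)} :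
    cnt (Function.update c j s) u + (if c j = u then 1 else 0) =
      cnt c u + if s = u then 1 else 0 := by
  have h (c' : Fin n → Finset (Fin 3)) : cnt c' u =
      ((Finset.univ.erase j).filter fun i => c' i = u).card + if c' j = u then 1 else 0 := by
    rw [cnt, ← Finset.insert_erase (Finset.mem_univ j), Finset.filter_insert]
    split_ifs <;> simp
  rw [h c, h (Function.update c j s), Finset.filter_congr (q := fun i => c i = u)]
  · simp; omega
  · intro i hi
    simp [(Finset.mem_erase.1 hi).1]

/-- The coefficients of `g` on words with one empty position are supported on the words in which
each letter `k ≠ 0` occurs `v k` times. -/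
def Good (g : Lm n) (v : Fin 3 → ℕ) : Prop :=
  ∀ (c : Fin n → Finset (Fin 3)) (i₀ : Fin n), c i₀ = ∅ → (∀ q, q ≠ i₀ → (c q).card = 1) →
    (F c g ≠ 0 ↔ ∀ k, k ≠ 0 → cnt c {k} = v k)

lemma good_vand : Good (vand n) 0 := by
  intro c i₀ hi hs
  refine ⟨fun h k hk => ?_, fun h => F_vand_ne_zero hi fun i hii => ?_⟩
  · by_contra hc
    obtain ⟨i, hi⟩ := exists_of_cnt_ne_zero hc
    exact h (F_vand_eq_zero hk (i := i) (by simp [hi]))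
  · obtain ⟨k, hk⟩ := Finset.card_eq_one.1 (hs i hii)
    by_cases hk0 : k = 0
    · rw [hk, hk0]
    · exact absurd (h k hk0) (cnt_pos hk).ne'

lemma Good.E {g : Lm n} (hg : IsAnti g) {v : Fin 3 → ℕ} (h : Good g v) {k : Fin 3} (hk : k ≠ 0) :
    Good (E k 0 g) (v + Pi.single k 1) := by
  intro c i₀ hi hs
  by_cases hc : cnt c {k} = 0
  · have h0 : F c (FermionicHarmonics.E k 0 g) = 0 := by
      refine F_E_eq_zero hk (fun i hki => ?_) g
      have hii : i ≠ i₀ := by rintro rfl; simp [hi] at hki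
      obtain ⟨l, hl⟩ := Finset.card_eq_one.1 (hs i hii)
      rw [hl, Finset.mem_singleton] at hki
      exact absurd hc (cnt_pos (hki ▸ hl)).ne'
    refine iff_of_false (by simp [h0]) fun h' => ?_
    have := h' k hk
    simp [hc] at this
  · obtain ⟨j, hj⟩ := exists_of_cnt_ne_zero hc
    have hji : j ≠ i₀ := by rintro rfl; simp [hi] at hj
    have h1 := F_E hg (c' := Function.update c j {0}) hk (fun i hki => Or.inl ?_) hj (by simp)
      fun q hq => by simp [hq]
    · have h2 := h (Function.update c j {0}) i₀ (by simp [hji.symm, hi]) fun q hq => by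
        by_cases hqj : q = j
        · simp [hqj]
        · simp [hqj, hs q hq]
      have hc' : ((Finset.univ.filter fun i => c i = {k}).card : ℚ) ≠ 0 := by
        rw [Nat.cast_ne_zero]; exact hc
      rw [Ne, h1.eq_zero_iff, mul_eq_zero, or_iff_right hc', ← Ne, h2]
      refine forall_congr' fun l => forall_congr' fun hl => ?_
      have h3 := cnt_update_add (c := c) (j := j) (s := {0}) (u := {l})
      rw [hj] at h3
      by_cases hkl : k = l
      · subst hkl
        simp [Ne.symm hk] at h3
        simp; omega
      · simp [hkl, Ne.symm hl] at h3
        simp [h3, Ne.symm hkl]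
    · have hii : i ≠ i₀ := by rintro rfl; simp [hi] at hki
      obtain ⟨l, hl⟩ := Finset.card_eq_one.1 (hs i hii)
      rw [hl, Finset.mem_singleton] at hki
      rw [hl, hki]

/-- For all multiplicities there is an antisymmetric harmonic element whose coefficients single
out the words with these multiplicities. -/
lemma exists_good (a b : ℕ) : ∃ g : Lm n, IsAH g ∧ IsLocal g ∧
    Good g (Pi.single 1 a + Pi.single 2 b) := by
  induction a with
  | zero =>
    induction b with
    | zero => exact ⟨vand n, isAH_vand, isLocal_vand, by simpa using good_vand⟩
    | succ b ih =>
      obtain ⟨g, h1, h2, h3⟩ := ih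
      refine ⟨E 2 0 g, h1.E 2 0, h2.E 2 0, ?_⟩
      have := h3.E h1.1 (k := 2) (by decide)
      rwa [add_assoc, ← Pi.single_add] at this
  | succ a ih =>
    obtain ⟨g, h1, h2, h3⟩ := ih
    refine ⟨E 1 0 g, h1.E 1 0, h2.E 1 0, ?_⟩
    have := h3.E h1.1 (k := 1) (by decide)
    rwa [add_right_comm, ← Pi.single_add] at this

/-- The operator replacing a letter `0` by the two letters `x` and `y`. -/
def R (x y : Fin 3) : Module.End ℚ (Lm n) := ∑ q, m (x, q) * m (y, q) * d (0, q)

lemma act_mul_R (σ : Equiv.Perm (Fin n)) (x y : Fin 3) : act σ * R x y = R x y * act σ := by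
  rw [R, Finset.mul_sum, Finset.sum_mul,
    ← Equiv.sum_comp σ fun q => m (x, q) * m (y, q) * d (0, q) * act σ]
  refine Finset.sum_congr rfl fun q _ => ?_
  rw [← mul_assoc, ← mul_assoc, act_mul_m, mul_assoc _ (act σ), act_mul_m, ← mul_assoc,
    mul_assoc _ (act σ), act_mul_d, ← mul_assoc]

lemma IsAnti.R {f : Lm n} (hf : IsAnti f) (x y : Fin 3) : IsAnti (R x y f) := by
  intro σ
  rw [← Module.End.mul_apply, act_mul_R, Module.End.mul_apply, hf, map_smul]

lemma IsAnti.add {f g : Lm n} (hf : IsAnti f) (hg : IsAnti g) : IsAnti (f + g) := by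
  intro σ
  rw [map_add, hf, hg, smul_add]

lemma IsAnti.smul {f : Lm n} (hf : IsAnti f) (a : ℚ) : IsAnti (a • f) := by
  intro σ
  rw [map_smul, hf, smul_comm]

lemma d_mul_R (l x y : Fin 3) (i : Fin n) :
    d (l, i) * R x y = -(R x y * d (l, i)) + (if l = x then m (y, i) * d (0, i) else 0)
      - (if l = y then m (x, i) * d (0, i) else 0) := by
  have h (q : Fin n) : d (l, i) * (m (x, q) * m (y, q) * d (0, q)) =
      -(m (x, q) * m (y, q) * d (0, q) * d (l, i)) +
      (if q = i then (if l = x then m (y, i) * d (0, i) else 0)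
      - (if l = y then m (x, i) * d (0, i) else 0) else 0) := by
    have h1 : d (l, i) * (m (x, q) * m (y, q) * d (0, q)) =
        (d (l, i) * m (x, q)) * m (y, q) * d (0, q) := by simp only [mul_assoc]
    have h2 : m (x, q) * d (l, i) * m (y, q) * d (0, q) =
        m (x, q) * (d (l, i) * m (y, q)) * d (0, q) := by simp only [mul_assoc]
    have h3 : m (x, q) * (m (y, q) * d (l, i)) * d (0, q) =
        m (x, q) * m (y, q) * (d (l, i) * d (0, q)) := by simp only [mul_assoc]
    rw [h1, d_mul_m, sub_mul, sub_mul, h2, d_mul_m, mul_sub, sub_mul, h3, d_mul_d (l, i)]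
    by_cases hq : q = i
    · subst hq
      by_cases hx : l = x <;> by_cases hy : l = y <;> simp [hx, hy, mul_assoc] <;> abel
    · simp [hq, Ne.symm hq, mul_assoc]
  rw [R, Finset.mul_sum, Finset.sum_mul, Finset.sum_congr rfl fun q _ => h q,
    Finset.sum_add_distrib]
  simp [add_sub_assoc]

lemma Dsum_mul_R (l x y : Fin 3) :
    Dsum l * R x y = -(R x y * Dsum l) + (if l = x then E y 0 else 0)
      - (if l = y then E x 0 else 0 : Module.End ℚ (Lm n)) := by
  rw [Dsum, Finset.sum_mul, Finset.sum_congr rfl fun i _ => d_mul_R l x y i,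
    Finset.sum_sub_distrib, Finset.sum_add_distrib, Finset.sum_neg_distrib, Finset.mul_sum]
  split_ifs <;> simp [E]

lemma Dsum_mul_E (a k l : Fin 3) :
    Dsum a * E k l = E k l * Dsum a + (if a = k then Dsum l else 0 : Module.End ℚ (Lm n)) := by
  rw [Dsum, Finset.sum_mul, Finset.sum_congr rfl fun i _ => d_mul_E a k l i,
    Finset.sum_add_distrib, Finset.mul_sum]
  split_ifs <;> simp [Dsum]

lemma E_mul_m (k l a : Fin 3) (i : Fin n) :
    E k l * m (a, i) = m (a, i) * E k l + if l = a then m (k, i) else 0 := by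
  have h (q : Fin n) : m (k, q) * d (l, q) * m (a, i) = m (a, i) * (m (k, q) * d (l, q)) +
      if q = i then (if l = a then m (k, i) else 0) else 0 := by
    rw [mul_assoc, d_mul_m, mul_sub, ← mul_assoc, ← mul_assoc, m_mul_m (k, q), neg_mul,
      sub_neg_eq_add, add_comm]
    congr 1
    by_cases hq : q = i
    · subst hq; by_cases hk : l = a <;> simp [hk]
    · simp [hq]
  rw [E, Finset.mul_sum, Finset.sum_mul, Finset.sum_congr rfl fun q _ => h q,
    Finset.sum_add_distrib]
  simp

/-- The commutation relations of `gl₃`. -/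
lemma E_mul_E (k l a b : Fin 3) :
    E k l * E a b = E a b * E k l + (if l = a then E k b else 0)
      - (if b = k then E a l else 0 : Module.End ℚ (Lm n)) := by
  have h (q : Fin n) : E k l * (m (a, q) * d (b, q)) = m (a, q) * d (b, q) * E k l +
      (if l = a then m (k, q) * d (b, q) else 0) - (if b = k then m (a, q) * d (l, q) else 0) := by
    rw [← mul_assoc, E_mul_m, add_mul, mul_assoc, mul_assoc, d_mul_E, mul_add]
    split_ifs <;> (try simp only [mul_zero, zero_mul]) <;> abel
  conv_lhs => rw [E.eq_1 a b, Finset.mul_sum, Finset.sum_congr rfl fun q _ => h q,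
    Finset.sum_sub_distrib, Finset.sum_add_distrib, ← Finset.sum_mul]
  rw [← E.eq_1 a b]
  split_ifs <;> simp [E]

lemma IsLocal.d_d_R {f : Lm n} (hf : IsLocal f) (a b x y : Fin 3) (i : Fin n) :
    d (a, i) (d (b, i) (R x y f)) =
      ((if b = x ∧ a = y then 1 else 0) - (if b = y ∧ a = x then 1 else 0) : ℚ) •
        d (0, i) f := by
  have h1 (l : Fin 3) (g : Lm n) : d (l, i) (R x y g) = -(R x y (d (l, i) g)) +
      (if l = x then m (y, i) (d (0, i) g) else 0) -
      (if l = y then m (x, i) (d (0, i) g) else 0) := by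
    have := congrArg (fun T : Module.End ℚ (Lm n) => T g) (d_mul_R l x y i)
    simp only [Module.End.mul_apply, LinearMap.add_apply, LinearMap.sub_apply,
      LinearMap.neg_apply] at this
    rw [this]
    split_ifs <;> simp
  have h2 (z : Fin 3) : d (a, i) (m (z, i) (d (0, i) f)) = if a = z then d (0, i) f else 0 := by
    rw [← Module.End.mul_apply, d_mul_m, LinearMap.sub_apply, Module.End.mul_apply, hf, map_zero,
      sub_zero]
    simp only [Prod.mk.injEq, and_true]
    split_ifs <;> simp
  rw [h1 b, map_sub, map_add, map_neg, h1 a]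
  simp only [hf i, map_zero]
  split_ifs <;> simp_all

/-- Harmonicity with respect to words of at least two contractions. -/
def IsHarmTwo (f : Lm n) : Prop := ∀ t : List (Fin 3), 2 ≤ t.length → ∑ i, dL t i f = 0

lemma IsHarmTwo.isHarm {f : Lm n} (hf : IsHarmTwo f) (h : ∀ k, Dsum k f = 0) : IsHarm f := by
  intro t ht
  match t with
  | [k] => simpa [Dsum, LinearMap.sum_apply] using h k
  | a :: b :: t => exact hf _ (by simp)

lemma IsHarmTwo.add {f g : Lm n} (hf : IsHarmTwo f) (hg : IsHarmTwo g) : IsHarmTwo (f + g) := by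
  intro t ht
  simp [Finset.sum_add_distrib, hf t ht, hg t ht]

lemma IsHarmTwo.smul {f : Lm n} (hf : IsHarmTwo f) (a : ℚ) : IsHarmTwo (a • f) := by
  intro t ht
  simp [← Finset.smul_sum, hf t ht]

lemma IsHarmTwo.E {f : Lm n} (hf : IsHarmTwo f) (k l : Fin 3) : IsHarmTwo (E k l f) :=
  fun _ ht => sum_dL_E_eq_zero (fun s hs => hf s (hs ▸ ht)) k l rfl

lemma Dsum_eq_zero {f : Lm n} (hf : IsHarm f) (k : Fin 3) : Dsum k f = 0 := by
  simpa [Dsum, LinearMap.sum_apply] using hf [k] (by simp)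

lemma IsLocal.isHarmTwo_R {f : Lm n} (hf : IsLocal f) (hf' : IsHarm f) (x y : Fin 3) :
    IsHarmTwo (R x y f) := by
  intro t ht
  obtain ⟨s, hs⟩ : ∃ s : ℚ, ∀ i, FermionicHarmonics.dL t i (FermionicHarmonics.R x y f) =
      s • d (0, i) f := by
    induction t with
    | nil => simp at ht
    | cons a t ih =>
      match t with
      | [] => simp at ht
      | [b] => exact ⟨_, fun i => by simpa using hf.d_d_R a b x y i⟩
      | b :: c :: t =>
        obtain ⟨s, hs⟩ := ih (by simp)
        refine ⟨0, fun i => ?_⟩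
        rw [dL_cons, Module.End.mul_apply, hs, map_smul, hf i, smul_zero, zero_smul]
  simp only [hs]
  have := Dsum_eq_zero hf' 0
  rw [Dsum, LinearMap.sum_apply] at this
  rw [← Finset.smul_sum, this, smul_zero]

/-- An operator on local antisymmetric harmonics producing a position with content `{1, 2}`. -/
def Ω (f : Lm n) : Lm n :=
  E 0 0 (R 1 2 f) + E 1 0 (R 2 0 f) + (-1 : ℚ) • E 2 0 (R 1 0 f) + (2 : ℚ) • R 1 2 f

lemma Dsum_Ω {f : Lm n} (hf : IsHarm f) (l : Fin 3) : Dsum l (Ω f) = 0 := by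
  have hR (x y : Fin 3) : Dsum l (R x y f) =
      (if l = x then E y 0 f else 0) - (if l = y then E x 0 f else 0) := by
    rw [← Module.End.mul_apply, Dsum_mul_R]
    split_ifs <;> simp [Dsum_eq_zero hf]
  have hR0 (x y : Fin 3) : Dsum 0 (R x y f) =
      (if 0 = x then E y 0 f else 0) - (if 0 = y then E x 0 f else 0) := by
    rw [← Module.End.mul_apply, Dsum_mul_R]
    split_ifs <;> simp [Dsum_eq_zero hf]
  have hE (k : Fin 3) (g : Lm n) : Dsum l (E k 0 g) = E k 0 (Dsum l g) +
      if l = k then Dsum 0 g else 0 := by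
    rw [← Module.End.mul_apply, Dsum_mul_E]
    split_ifs <;> simp
  have hEE (k a : Fin 3) : E k 0 (E a 0 f) = E a 0 (E k 0 f) + (if 0 = a then E k 0 f else 0)
      - (if 0 = k then E a 0 f else 0) := by
    rw [← Module.End.mul_apply, E_mul_E]
    split_ifs <;> simp
  have h01 := hEE 0 1
  have h02 := hEE 0 2
  have h12 := hEE 1 2
  simp only [Ω, map_add, map_smul, hE, hR, hR0]
  fin_cases l <;> simp at h01 h02 h12 ⊢
  · rw [h12]; abel
  · rw [h02]; module
  · rw [h01]; module

lemma isAH_Ω {f : Lm n} (hf : IsAH f) (hl : IsLocal f) : IsAH (Ω f) := by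
  have hA := hf.1.R
  have hH := hl.isHarmTwo_R hf.2
  exact ⟨((((hA 1 2).E 0 0).add ((hA 2 0).E 1 0)).add (((hA 1 0).E 2 0).smul _)).add
      ((hA 1 2).smul _),
    (((((hH 1 2).E 0 0).add ((hH 2 0).E 1 0)).add (((hH 1 0).E 2 0).smul _)).add
      ((hH 1 2).smul _)).isHarm (Dsum_Ω hf.2)⟩

lemma F_E_self (c : Fin n → Finset (Fin 3)) (k : Fin 3) (f : Lm n) :
    F c (E k k f) = (Finset.univ.filter fun q => k ∈ c q).card * F c f := by
  rw [ε_Op_E, Finset.card_filter, Nat.cast_sum, Finset.sum_mul]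
  refine Finset.sum_congr rfl fun q _ => ?_
  by_cases hq : k ∈ c q
  · have : m (k, q) * d (k, q) = 1 - d (k, q) * m (k, q) := by rw [d_mul_m_self]; abel
    rw [← Module.End.mul_apply (m _), this, LinearMap.sub_apply, map_sub, Module.End.mul_apply,
      ← Module.End.mul_apply (Op c) (d _), Op_mul_d_eq_zero hq]
    simp [hq, F]
  · simp [hq, ε_Op_m hq]

lemma F_R_eq_zero {c : Fin n → Finset (Fin 3)} (hc : ∀ q, (c q).card ≤ 1) {x y : Fin 3}
    (hxy : x ≠ y) (f : Lm n) : F c (R x y f) = 0 := by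
  rw [F, R, LinearMap.sum_apply, map_sum, map_sum]
  refine Finset.sum_eq_zero fun q _ => ?_
  rw [Module.End.mul_apply]
  by_cases hx : x ∈ c q
  · have hy : y ∉ c q := fun hy => hxy (Finset.card_le_one.1 (hc q) x hx y hy)
    rw [m_mul_m, LinearMap.neg_apply, map_neg, map_neg, Module.End.mul_apply, ε_Op_m hy, neg_zero]
  · rw [Module.End.mul_apply, ε_Op_m hx]

lemma F_E_R_eq_zero {c : Fin n → Finset (Fin 3)} (hc : ∀ q, (c q).card ≤ 1) {x y k : Fin 3}
    (hxy : x ≠ y) (f : Lm n) : F c (E k 0 (R x y f)) = 0 := by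
  rw [ε_Op_E]
  refine Finset.sum_eq_zero fun q _ => ?_
  by_cases hk : k ∈ c q
  · have hq : c q = {k} := Finset.eq_singleton_iff_unique_mem.2
      ⟨hk, fun l hl => Finset.card_le_one.1 (hc q) l hl k hk⟩
    refine (ε_Op_m_d (c' := Function.update c q {0}) hq (by simp)
      (fun r hr => by simp [hr]) _).eq_zero_iff.2 (F_R_eq_zero (fun r => ?_) hxy f)
    by_cases hr : r = q
    · simp [hr]
    · simp [hr, hc r]
  · exact ε_Op_m hk _

lemma F_Ω_eq_zero {c : Fin n → Finset (Fin 3)} (hc : ∀ q, (c q).card ≤ 1) (f : Lm n) :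
    F c (Ω f) = 0 := by
  have h1 := F_E_R_eq_zero hc (k := 0) (x := 1) (y := 2) (by decide) f
  have h2 := F_E_R_eq_zero hc (k := 1) (x := 2) (y := 0) (by decide) f
  have h3 := F_E_R_eq_zero hc (k := 2) (x := 1) (y := 0) (by decide) f
  have h4 := F_R_eq_zero hc (x := 1) (y := 2) (by decide) f
  simp only [F] at h1 h2 h3 h4 ⊢
  simp [Ω, h1, h2, h3, h4]

lemma IsLocal.d_d_Ω {f : Lm n} (hf : IsLocal f) (i : Fin n) :
    d (1, i) (d (2, i) (Ω f)) = -FermionicHarmonics.E 0 0 (d (0, i) f) := by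
  have hE (a k : Fin 3) (g : Lm n) : d (a, i) (FermionicHarmonics.E k 0 g) =
      FermionicHarmonics.E k 0 (d (a, i) g) + if a = k then d (0, i) g else 0 := by
    rw [← Module.End.mul_apply, d_mul_E]
    split_ifs <;> simp
  simp only [Ω, map_add, map_smul, hE]
  simp [hf.d_d_R]
  module

lemma F_Ω {f : Lm n} (hf : IsLocal f) {c : Fin n → Finset (Fin 3)} {j : Fin n}
    (hj : c j = {1, 2}) :
    SEq (F c (Ω f)) ((Finset.univ.filter fun q => 0 ∈ c q).card *
      F (Function.update c j {0}) f) := by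
  set c₀ := Function.update c j ∅ with hc₀
  have h1 : SEq (Op c₀ * d (1, j)) (Op (Function.update c j {1})) :=
    Op_mul_d (by simp [hc₀]) (by simp [hc₀]) fun q hq => by simp [hc₀, hq]
  have h2 : SEq (Op (Function.update c j {1}) * d (2, j)) (Op c) :=
    Op_mul_d (by simp) (by simp [hj, Finset.pair_comm]) fun q hq => by simp [hq]
  have h3 : SEq (Op c₀ * d (0, j)) (Op (Function.update c j {0})) :=
    Op_mul_d (by simp [hc₀]) (by simp [hc₀]) fun q hq => by simp [hc₀, hq]
  have h4 := ((h1.mul_right (d (2, j))).trans h2).ε_apply (Ω f)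
  rw [Module.End.mul_apply, Module.End.mul_apply, hf.d_d_Ω, map_neg, map_neg, ← F,
    F_E_self] at h4
  have h5 : (Finset.univ.filter fun q => 0 ∈ c₀ q) = Finset.univ.filter fun q => 0 ∈ c q := by
    refine Finset.filter_congr fun q _ => ?_
    by_cases hq : q = j
    · subst hq; simp [hc₀, hj]
    · simp [hc₀, hq]
  rw [h5] at h4
  refine h4.symm.trans ?_
  rcases h3.ε_apply f with h | h <;> rw [Module.End.mul_apply] at h <;> rw [F, h] <;>
    simp [SEq, F]

/-- The dimension of a subspace is the number of functionals in a dual family separating its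
points. -/
lemma finrank_eq_card_of_dual {M I : Type*} [AddCommGroup M] [Module ℚ M] [Fintype I]
    (S : Submodule ℚ M) (φ : I → M →ₗ[ℚ] ℚ) (hinj : ∀ f ∈ S, (∀ i, φ i f = 0) → f = 0)
    (hsurj : ∀ i, ∃ g ∈ S, ∀ j, φ j g ≠ 0 ↔ j = i) :
    Module.finrank ℚ S = Fintype.card I := by
  classical
  let Φ : S →ₗ[ℚ] (I → ℚ) := LinearMap.pi fun i => φ i ∘ₗ S.subtype
  have h1 : Function.Injective Φ := by
    rw [injective_iff_map_eq_zero]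
    exact fun f hf => Subtype.ext (hinj f f.2 fun i => congrFun hf i)
  have h2 : Function.Surjective Φ := by
    choose g hg hφ using hsurj
    intro v
    refine ⟨∑ i, (v i / φ i (g i)) • ⟨g i, hg i⟩, funext fun j => ?_⟩
    rw [map_sum, Finset.sum_apply, Finset.sum_eq_single j]
    · rw [map_smul]
      change v j / φ j (g j) * φ j (g j) = v j
      exact div_mul_cancel₀ _ ((hφ j j).2 rfl)
    · intro i _ hi
      rw [map_smul]
      change v i / φ i (g i) * φ j (g i) = 0
      rw [not_not.1 (mt (hφ i j).1 (Ne.symm hi)), mul_zero]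
    · simp
  rw [(LinearEquiv.ofBijective Φ ⟨h1, h2⟩).finrank_eq, Module.finrank_fintype_fun_eq_card]

lemma sum_cnt (c : Fin n → Finset (Fin 3)) : ∑ s, cnt c s = n := by
  simpa [cnt] using (Finset.card_eq_sum_card_fiberwise (f := c) (s := Finset.univ) (t := Finset.univ)
    (by simp)).symm

lemma sum_subsets (v : Finset (Fin 3) → ℕ) : ∑ s, v s = v ∅ + v {0} + v {1} + v {2} + v {0, 1} +
    v {0, 2} + v {1, 2} + v Finset.univ := by
  have h : (Finset.univ : Finset (Finset (Fin 3))) =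
      {∅, {0}, {1}, {2}, {0, 1}, {0, 2}, {1, 2}, Finset.univ} := by decide
  rw [h, Finset.sum_insert (by decide), Finset.sum_insert (by decide),
    Finset.sum_insert (by decide), Finset.sum_insert (by decide), Finset.sum_insert (by decide),
    Finset.sum_insert (by decide), Finset.sum_insert (by decide), Finset.sum_singleton]
  ring

lemma exists_perm_of_cnt {c c' : Fin n → Finset (Fin 3)} (h : ∀ s, cnt c s = cnt c' s) :
    ∃ σ : Equiv.Perm (Fin n), c' ∘ σ = c := by
  have e (s : Finset (Fin 3)) : Nonempty ({i // c i = s} ≃ {i // c' i = s}) := by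
    refine ⟨Fintype.equivOfCardEq ?_⟩
    rw [Fintype.card_subtype, Fintype.card_subtype]
    exact h s
  exact ⟨Equiv.ofFiberEquiv fun s => (e s).some, funext fun i => Equiv.ofFiberEquiv_map _ i⟩

lemma exists_cnt_eq {v : Finset (Fin 3) → ℕ} (hv : ∑ s, v s = n) :
    ∃ c : Fin n → Finset (Fin 3), ∀ s, cnt c s = v s := by
  have e : (Σ s, Fin (v s)) ≃ Fin n := Fintype.equivFinOfCardEq (by simpa using hv)
  refine ⟨fun i => (e.symm i).1, fun s => ?_⟩
  rw [cnt, ← Fintype.card_subtype, ← Fintype.card_fin (v s)]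
  exact Fintype.card_congr ((e.symm.subtypeEquiv fun i => Iff.rfl).trans (Equiv.sigmaSubtype s))

/-- The word `c` has one empty position, `a` positions `{1}`, `b` positions `{2}`, `p` positions
`{1, 2}`, and all other positions are `{0}`. -/
structure HasType (c : Fin n → Finset (Fin 3)) (a b p : ℕ) : Prop where
  cnt_empty : cnt c ∅ = 1
  cnt_one : cnt c {1} = a
  cnt_two : cnt c {2} = b
  cnt_pair : cnt c {1, 2} = p
  cnt_zero_one : cnt c {0, 1} = 0
  cnt_zero_two : cnt c {0, 2} = 0
  cnt_univ : cnt c Finset.univ = 0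

namespace HasType

variable {c c' : Fin n → Finset (Fin 3)} {a b p : ℕ}

lemma cnt_zero (h : HasType c a b p) : 1 + cnt c {0} + a + b + p = n := by
  have := sum_cnt c
  rw [sum_subsets, h.cnt_empty, h.cnt_one, h.cnt_two, h.cnt_pair, h.cnt_zero_one, h.cnt_zero_two,
    h.cnt_univ] at this
  omega

lemma cnt_eq (h : HasType c a b p) (h' : HasType c' a b p) (s : Finset (Fin 3)) :
    cnt c s = cnt c' s := by
  have hs : ∀ s : Finset (Fin 3), s = ∅ ∨ s = {0} ∨ s = {1} ∨ s = {2} ∨ s = {0, 1} ∨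
    s = {0, 2} ∨ s = {1, 2} ∨ s = Finset.univ := by decide
  rcases hs s with rfl | rfl | rfl | rfl | rfl | rfl | rfl | rfl
  · rw [h.cnt_empty, h'.cnt_empty]
  · have := h.cnt_zero
    have := h'.cnt_zero
    omega
  · rw [h.cnt_one, h'.cnt_one]
  · rw [h.cnt_two, h'.cnt_two]
  · rw [h.cnt_zero_one, h'.cnt_zero_one]
  · rw [h.cnt_zero_two, h'.cnt_zero_two]
  · rw [h.cnt_pair, h'.cnt_pair]
  · rw [h.cnt_univ, h'.cnt_univ]

lemma F_eq_zero_iff (h : HasType c a b p) (h' : HasType c' a b p) {f : Lm n} (hf : IsAnti f) :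
    F c f = 0 ↔ F c' f = 0 := by
  obtain ⟨σ, rfl⟩ := exists_perm_of_cnt (h.cnt_eq h')
  exact F_comp_perm hf σ c'

lemma exists_word (h : a + b + p + 1 ≤ n) : ∃ c : Fin n → Finset (Fin 3), HasType c a b p := by
  obtain ⟨c, hc⟩ := exists_cnt_eq (n := n) (v := fun s => if s = ∅ then 1 else
    if s = {1} then a else if s = {2} then b else if s = {1, 2} then p else
    if s = {0} then n - 1 - a - b - p else 0) (by
      rw [sum_subsets]
      simp +decide
      omega)
  exact ⟨c, by constructor <;> rw [hc] <;> simp +decide⟩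

lemma exists_empty (h : HasType c a b p) : ∃ i₀, c i₀ = ∅ ∧
    ∀ q, q ≠ i₀ → (c q).card = 1 ∨ c q = {1, 2} := by
  obtain ⟨i₀, hi⟩ := Finset.card_eq_one.1 h.cnt_empty
  have hi' (q : Fin n) : c q = ∅ ↔ q = i₀ := by
    simpa using Finset.ext_iff.1 hi q
  refine ⟨i₀, (hi' i₀).2 rfl, fun q hq => ?_⟩
  have hs : ∀ s : Finset (Fin 3), s = ∅ ∨ s.card = 1 ∨ s = {1, 2} ∨ s = {0, 1} ∨ s = {0, 2} ∨
    s = Finset.univ := by decide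
  rcases hs (c q) with h0 | h0 | h0 | h0 | h0 | h0
  · exact absurd ((hi' q).1 h0) hq
  · exact Or.inl h0
  · exact Or.inr h0
  · exact absurd h.cnt_zero_one (cnt_pos h0).ne'
  · exact absurd h.cnt_zero_two (cnt_pos h0).ne'
  · exact absurd h.cnt_univ (cnt_pos h0).ne'

lemma exists_empty_of_zero (h : HasType c a b 0) :
    ∃ i₀, c i₀ = ∅ ∧ ∀ q, q ≠ i₀ → (c q).card = 1 := by
  obtain ⟨i₀, hi, hs⟩ := h.exists_empty
  exact ⟨i₀, hi, fun q hq => (hs q hq).resolve_right fun h0 =>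
    (cnt_pos h0).ne' h.cnt_pair⟩

lemma update (h : HasType c a b (p + 1)) {j : Fin n} (hj : c j = {1, 2}) :
    HasType (Function.update c j {0}) a b p := by
  have h' (u : Finset (Fin 3)) := cnt_update_add (c := c) (j := j) (s := {0}) (u := u)
  simp only [hj] at h'
  constructor
  · simpa +decide [h.cnt_empty] using h' ∅
  · simpa +decide [h.cnt_one] using h' {1}
  · simpa +decide [h.cnt_two] using h' {2}
  · simpa +decide [h.cnt_pair] using h' {1, 2}
  · simpa +decide [h.cnt_zero_one] using h' {0, 1}
  · simpa +decide [h.cnt_zero_two] using h' {0, 2}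
  · simpa +decide [h.cnt_univ] using h' Finset.univ

lemma F_good (h : HasType c a b 0) {g : Lm n} {a' b' : ℕ}
    (hg : Good g (Pi.single 1 a' + Pi.single 2 b')) : F c g ≠ 0 ↔ a = a' ∧ b = b' := by
  obtain ⟨i₀, hi, hs⟩ := h.exists_empty_of_zero
  rw [hg c i₀ hi hs]
  constructor
  · intro hk
    have h1 := hk 1 (by decide)
    have h2 := hk 2 (by decide)
    rw [h.cnt_one] at h1
    rw [h.cnt_two] at h2
    simpa +decide using And.intro h1 h2
  · rintro ⟨rfl, rfl⟩ k hk
    fin_cases k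
    · exact absurd rfl hk
    · simpa +decide using h.cnt_one
    · simpa +decide using h.cnt_two

lemma F_Ω_good (h : HasType c a b 1) (hab : a + b + 3 ≤ n) {g : Lm n} (hl : IsLocal g) {a' b' : ℕ}
    (hg : Good g (Pi.single 1 a' + Pi.single 2 b')) : F c (Ω g) ≠ 0 ↔ a = a' ∧ b = b' := by
  obtain ⟨j, hj⟩ := exists_of_cnt_ne_zero (c := c) (s := {1, 2}) (by simp [h.cnt_pair])
  obtain ⟨j', hj'⟩ := exists_of_cnt_ne_zero (c := c) (s := {0}) (by have := h.cnt_zero; omega)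
  have h0 : ((Finset.univ.filter fun q => 0 ∈ c q).card : ℚ) ≠ 0 := by
    rw [Nat.cast_ne_zero]
    exact Finset.card_ne_zero_of_mem (a := j') (by simp [hj'])
  rw [Ne, (F_Ω hl hj).eq_zero_iff, mul_eq_zero, or_iff_right h0, ← Ne, (h.update hj).F_good hg]

end HasType

lemma IsLocal.F_eq_zero {f : Lm n} (hf : IsLocal f) {c : Fin n → Finset (Fin 3)} {j : Fin n}
    (hj : c j = {1, 2}) : F c f = 0 := by
  have h1 : SEq (Op (Function.update c j ∅) * d (1, j)) (Op (Function.update c j {1})) :=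
    Op_mul_d (by simp) (by simp) fun q hq => by simp [hq]
  have h2 : SEq (Op (Function.update c j {1}) * d (2, j)) (Op c) :=
    Op_mul_d (by simp) (by simp [hj, Finset.pair_comm]) fun q hq => by simp [hq]
  have h3 := ((h1.mul_right (d (2, j))).trans h2).ε_apply f
  refine h3.eq_zero_iff.1 ?_
  rw [Module.End.mul_apply, Module.End.mul_apply, hf]
  simp

lemma cnt_eq_zero {c : Fin n → Finset (Fin 3)} {s : Finset (Fin 3)} (h : ∀ q, c q ≠ s) :
    cnt c s = 0 := by
  simpa [cnt, Finset.filter_eq_empty_iff] using h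

lemma cnt_eq_one {c : Fin n → Finset (Fin 3)} {s : Finset (Fin 3)} {i : Fin n} (hi : c i = s)
    (h : ∀ q, q ≠ i → c q ≠ s) : cnt c s = 1 := by
  refine Finset.card_eq_one.2 ⟨i, Finset.ext fun q => ?_⟩
  by_cases hq : q = i
  · simp [hq, hi]
  · simp [hq, h q hq]

lemma hasType_zero {c : Fin n → Finset (Fin 3)} {i₀ : Fin n} (hi : c i₀ = ∅)
    (hs : ∀ q, q ≠ i₀ → (c q).card = 1) : HasType c (cnt c {1}) (cnt c {2}) 0 := by
  have h0 {s : Finset (Fin 3)} (h1 : s ≠ ∅) (h2 : s.card ≠ 1) : cnt c s = 0 := by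
    refine cnt_eq_zero fun q hq => ?_
    by_cases hqi : q = i₀
    · exact h1 (by rw [← hq, hqi, hi])
    · exact h2 (hq ▸ hs q hqi)
  exact ⟨cnt_eq_one hi fun q hq h => by simpa [h] using hs q hq, rfl, rfl,
    h0 (by decide) (by decide), h0 (by decide) (by decide), h0 (by decide) (by decide),
    h0 (by decide) (by decide)⟩

lemma hasType_one {c : Fin n → Finset (Fin 3)} {i₀ j : Fin n} (hi : c i₀ = ∅) (hj : c j = {1, 2})
    (hs : ∀ q, q ≠ i₀ → q ≠ j → (c q).card = 1) : HasType c (cnt c {1}) (cnt c {2}) 1 := by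
  have h0 {s : Finset (Fin 3)} (h1 : s ≠ ∅) (h2 : s ≠ {1, 2}) (h3 : s.card ≠ 1) : cnt c s = 0 := by
    refine cnt_eq_zero fun q hq => ?_
    by_cases hqi : q = i₀
    · exact h1 (by rw [← hq, hqi, hi])
    · by_cases hqj : q = j
      · exact h2 (by rw [← hq, hqj, hj])
      · exact h3 (hq ▸ hs q hqi hqj)
  refine ⟨cnt_eq_one hi fun q hq h => ?_, rfl, rfl, cnt_eq_one hj fun q hq h => ?_,
    h0 (by decide) (by decide) (by decide), h0 (by decide) (by decide) (by decide),
    h0 (by decide) (by decide) (by decide)⟩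
  · by_cases hqj : q = j
    · subst hqj; simp +decide [h] at hj
    · simpa [h] using hs q hq hqj
  · by_cases hqi : q = i₀
    · subst hqi; simp [h] at hi
    · simpa +decide [h] using hs q hqi hq

/-- The types of the words which determine an antisymmetric harmonic element: the pairs `(a, b)`
with `a + b < n`, and the pairs `(a, b)` with `a + b < n - 2`. -/
abbrev Idx (n : ℕ) : Type := (Σ k : Fin n, Fin (k + 1)) ⊕ (Σ k : Fin (n - 2), Fin (k + 1))

lemma card_Idx (hn : 1 ≤ n) : Fintype.card (Idx n) = n ^ 2 - n + 1 := by
  have h (N : ℕ) : 2 * ∑ k : Fin N, ((k : ℕ) + 1) = N * (N + 1) := by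
    rw [Fin.sum_univ_eq_sum_range (fun k => k + 1) N]
    induction N with
    | zero => rfl
    | succ N ih => rw [Finset.sum_range_succ, mul_add, ih]; ring
  simp only [Fintype.card_sum, Fintype.card_sigma, Fintype.card_fin]
  have h1 := h n
  have h2 := h (n - 2)
  obtain rfl | ⟨N, rfl⟩ : n = 1 ∨ ∃ N, n = N + 2 := by
    rcases Nat.lt_or_ge n 2 with h | h
    · left; omega
    · exact Or.inr ⟨n - 2, by omega⟩
  · simp
  · simp only [Nat.add_sub_cancel] at h2 ⊢
    have h3 : (N + 2) ^ 2 - (N + 2) = (N + 2) * (N + 1) := by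
      rw [pow_two, ← Nat.mul_sub_one]; rfl
    rw [h3]
    nlinarith

/-- A word of the type given by an index. -/
lemma exists_words (n : ℕ) : ∃ w : Idx n → Fin n → Finset (Fin 3),
    (∀ k a, HasType (w (Sum.inl ⟨k, a⟩)) a (k - a) 0) ∧
    ∀ k a, HasType (w (Sum.inr ⟨k, a⟩)) a (k - a) 1 := by
  have h1 (x : Σ k : Fin n, Fin (k + 1)) :
      ∃ c : Fin n → Finset (Fin 3), HasType c x.2 (x.1 - x.2) 0 :=
    HasType.exists_word (by have := x.1.2; have := x.2.2; omega)
  have h2 (x : Σ k : Fin (n - 2), Fin (k + 1)) :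
      ∃ c : Fin n → Finset (Fin 3), HasType c x.2 (x.1 - x.2) 1 :=
    HasType.exists_word (by have := x.1.2; have := x.2.2; omega)
  choose w1 hw1 using h1
  choose w2 hw2 using h2
  exact ⟨Sum.elim w1 w2, fun k a => hw1 ⟨k, a⟩, fun k a => hw2 ⟨k, a⟩⟩

lemma sigma_eq_iff {N : ℕ} {x y : Σ k : Fin N, Fin (k + 1)} :
    ((x.2 : ℕ) = y.2 ∧ (x.1 - x.2 : ℕ) = y.1 - y.2) ↔ x = y := by
  refine ⟨fun ⟨h1, h2⟩ => ?_, by rintro rfl; exact ⟨rfl, rfl⟩⟩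
  obtain ⟨k, a⟩ := x
  obtain ⟨l, b⟩ := y
  have hk : k = l := Fin.ext (by
    have := a.2
    have := b.2
    simp only at h1 h2
    omega)
  subst hk
  exact congrArg _ (Fin.ext h1)

theorem finrank_AH (hn : 1 ≤ n) : Module.finrank ℚ (AH n) = n ^ 2 - n + 1 := by
  rw [← card_Idx hn]
  obtain ⟨w, hw1, hw2⟩ := exists_words n
  refine finrank_eq_card_of_dual (M := Lm n) (AH n) (fun x => ε ∘ₗ Op (w x)) (fun f hf h => ?_) ?_
  · have hf' := isAH_iff.2 hf
    refine eq_zero_of_F hn hf' (fun c i₀ hi hs => ?_) fun c i₀ j j' hi hj hj' hs => ?_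
    · have hc := hasType_zero hi hs
      have := hc.cnt_zero
      have h' := hw1 ⟨cnt c {1} + cnt c {2}, by omega⟩ ⟨cnt c {1}, by simp⟩
      simp only [Nat.add_sub_cancel_left] at h'
      exact (hc.F_eq_zero_iff h' hf'.1).2 (h _)
    · have hc := hasType_one hi hj hs
      have := hc.cnt_zero
      have := cnt_pos hj'
      have h' := hw2 ⟨cnt c {1} + cnt c {2}, by omega⟩ ⟨cnt c {1}, by simp⟩
      simp only [Nat.add_sub_cancel_left] at h'
      exact (hc.F_eq_zero_iff h' hf'.1).2 (h _)
  · rintro (⟨k, a⟩ | ⟨k, a⟩)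
    all_goals obtain ⟨g, h1, h2, h3⟩ := exists_good (n := n) a (k - a)
    · refine ⟨g, isAH_iff.1 h1, ?_⟩
      rintro (⟨l, b⟩ | ⟨l, b⟩)
      · rw [Sum.inl.injEq, ← sigma_eq_iff]
        exact (hw1 l b).F_good h3
      · obtain ⟨j, hj⟩ := exists_of_cnt_ne_zero (c := w (Sum.inr ⟨l, b⟩)) (s := {1, 2})
          (by simp [(hw2 l b).cnt_pair])
        exact iff_of_false (not_not.2 (h2.F_eq_zero hj)) (by simp)
    · refine ⟨Ω g, isAH_iff.1 (isAH_Ω h1 h2), ?_⟩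
      rintro (⟨l, b⟩ | ⟨l, b⟩)
      · obtain ⟨i₀, hi, hs⟩ := (hw1 l b).exists_empty_of_zero
        refine iff_of_false (not_not.2 (F_Ω_eq_zero (fun q => ?_) g)) (by simp)
        by_cases hq : q = i₀
        · simp [hq, hi]
        · exact (hs q hq).le
      · rw [Sum.inr.injEq, ← sigma_eq_iff]
        exact (hw2 l b).F_Ω_good (by have := l.2; have := b.2; omega) h2 h3

end FermionicHarmonics

/-- The total multiplicity of the sign character in `R_n^{(0,3)}`
is `n² - n + 1` (Bergeron's conjecture). -/
theorem sign_character_dimension (n : ℕ) (hn : 1 ≤ n) :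
    Module.finrank ℚ ↥(AH n) = n ^ 2 - n + 1 := by
  exact FermionicHarmonics.finrank_AH hn
end
end

section
/- Let n ≥ 1 and let f ∈ Λ be antisymmetric, harmonic, and lie in the ℚ-subalgebra of Λ generated by θ_1,…,θ_n (i.e., f involves only the θ-variables). If f ≠ 0, then f is homogeneous of degree exactly n−1 in the θ-variables; that is, f ∈ Λ_{n−1,0,0}. -/
noncomputable section

open ExteriorAlgebra

/-- The trigraded component `Λ_{a,b,c}`: the ℚ-linear span of all products
`θ_{i_1}⋯θ_{i_a} · ξ_{j_1}⋯ξ_{j_b} · ρ_{k_1}⋯ρ_{k_c}` with strictly increasing indices. -/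
def lamGrade (n : ℕ) (a b c : ℕ) : Submodule ℚ (Lam n) :=
  Submodule.span ℚ { x | ∃ (p : Fin a → Fin n) (q : Fin b → Fin n) (r : Fin c → Fin n),
    StrictMono p ∧ StrictMono q ∧ StrictMono r ∧
    x = (List.ofFn fun i => θ n (p i)).prod * (List.ofFn fun i => ξ n (q i)).prod *
        (List.ofFn fun i => ρ n (r i)).prod }

section Helpers

variable {n : ℕ}

theorem dθ_θ_mul (i k : Fin n) (x : Lam n) :
    dθ n i (θ n k * x) = (if i = k then x else 0) - θ n k * dθ n i x := by
  rw [dθ, θ, ExteriorAlgebra.ι, CliffordAlgebra.contractLeft_ι_mul]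
  by_cases h : i = k <;> simp [e, h]

theorem θ_mul_θ_mul_self (i : Fin n) (x : Lam n) : θ n i * (θ n i * x) = 0 := by
  rw [← mul_assoc, θ, ExteriorAlgebra.ι_sq_zero, zero_mul]

theorem dθ_dθ_comm (i j : Fin n) (x : Lam n) : dθ n i (dθ n j x) = -dθ n j (dθ n i x) :=
  CliffordAlgebra.contractLeft_comm _ _ _

/-- The algebra endomorphism of `Λ` setting `θ_i` to zero. -/
def killθ (n : ℕ) (i : Fin n) : Lam n →ₐ[ℚ] Lam n :=
  ExteriorAlgebra.map (LinearMap.id - (LinearMap.proj ((0 : Fin 3), i)).smulRight (e n 0 i))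

theorem killθ_ι (i : Fin n) (v : V n) :
    killθ n i (ExteriorAlgebra.ι ℚ v) = ExteriorAlgebra.ι ℚ v - v (0, i) • θ n i := by
  simp [killθ, ExteriorAlgebra.map_apply_ι, θ]

theorem killθ_θ (i k : Fin n) : killθ n i (θ n k) = if i = k then 0 else θ n k := by
  rw [θ, killθ_ι]
  by_cases h : i = k <;> simp [e, h, θ]

theorem killθ_apply (i : Fin n) (x : Lam n) : killθ n i x = x - θ n i * dθ n i x := by
  induction x using CliffordAlgebra.left_induction with
  | algebraMap r => simp [dθ, AlgHomClass.commutes]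
  | add x y hx hy => simp only [map_add, hx, hy, mul_add]; abel
  | ι_mul x v hx =>
    have hanti : θ n i * ExteriorAlgebra.ι ℚ v = -(ExteriorAlgebra.ι ℚ v * θ n i) :=
      eq_neg_of_add_eq_zero_left (ExteriorAlgebra.ι_add_mul_swap _ _)
    have h : dθ n i (ExteriorAlgebra.ι ℚ v * x)
        = v (0, i) • x - ExteriorAlgebra.ι ℚ v * dθ n i x := by
      rw [dθ, ExteriorAlgebra.ι, CliffordAlgebra.contractLeft_ι_mul]; simp
    change killθ n i (ExteriorAlgebra.ι ℚ v * x) = ExteriorAlgebra.ι ℚ v * x - _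
    change _ = _ - θ n i * dθ n i (ExteriorAlgebra.ι ℚ v * x)
    rw [map_mul, hx, killθ_ι, h, mul_sub (θ n i), ← mul_assoc (θ n i), hanti]
    simp only [sub_mul, mul_sub, smul_mul_assoc, θ_mul_θ_mul_self, mul_smul_comm, neg_mul,
      mul_assoc, smul_zero]
    abel

theorem A_θ (σ : Equiv.Perm (Fin n)) (k : Fin n) : A n σ (θ n k) = θ n (σ k) := by
  rw [A, θ, θ, ExteriorAlgebra.map_apply_ι]
  congr 1
  ext ⟨a, b⟩
  simp [e, LinearMap.funLeft_apply, Pi.single_apply, Equiv.symm_apply_eq]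

/-- An antisymmetric element has no term avoiding two of the variables. -/
theorem killθ_killθ_eq_zero {f : Lam n} (hanti : IsAntisymmetric n f)
    (hvars : f ∈ Algebra.adjoin ℚ (Set.range (θ n))) {i j : Fin n} (hij : i ≠ j) :
    killθ n j (killθ n i f) = 0 := by
  have key : killθ n j (killθ n i (A n (Equiv.swap i j) f)) = killθ n j (killθ n i f) := by
    have hle : Algebra.adjoin ℚ (Set.range (θ n)) ≤
        AlgHom.equalizer (((killθ n j).comp (killθ n i)).comp (A n (Equiv.swap i j)))
          ((killθ n j).comp (killθ n i)) := by
      rw [Algebra.adjoin_le_iff]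
      rintro _ ⟨k, rfl⟩
      simp only [SetLike.mem_coe, AlgHom.mem_equalizer, AlgHom.comp_apply, A_θ, killθ_θ]
      rcases eq_or_ne k i with rfl | hki
      · simp [hij, killθ_θ]
      rcases eq_or_ne k j with rfl | hkj
      · simp [hij, killθ_θ]
      rw [Equiv.swap_apply_of_ne_of_ne hki hkj]
    exact hle hvars
  rw [hanti, Equiv.Perm.sign_swap hij] at key
  have key' : -killθ n j (killθ n i f) = killθ n j (killθ n i f) := by simpa using key
  have : IsAddTorsionFree (Lam n) := .of_module_rat _
  exact self_eq_neg.mp key'.symm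

/-- The Euler operator, multiplying each monomial by its degree in the `θ` variables. -/
def eulerθ (n : ℕ) : Module.End ℚ (Lam n) :=
  ∑ i : Fin n, LinearMap.mulLeft ℚ (θ n i) ∘ₗ dθ n i

theorem eulerθ_apply (x : Lam n) : eulerθ n x = ∑ i, θ n i * dθ n i x := by
  simp [eulerθ]

theorem eulerθ_θ_mul (k : Fin n) (x : Lam n) :
    eulerθ n (θ n k * x) = θ n k * x + θ n k * eulerθ n x := by
  have hanti (i : Fin n) : θ n i * θ n k = -(θ n k * θ n i) :=
    eq_neg_of_add_eq_zero_left (ExteriorAlgebra.ι_add_mul_swap _ _)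
  simp only [eulerθ_apply, dθ_θ_mul, mul_sub, ← mul_assoc, hanti]
  simp [Finset.sum_add_distrib, Finset.mul_sum, mul_assoc]

theorem eulerθ_prod (l : List (Fin n)) :
    eulerθ n (l.map (θ n)).prod = (l.length : ℚ) • (l.map (θ n)).prod := by
  induction l with
  | nil => simp [eulerθ_apply, dθ]
  | cons k l ih =>
    rw [List.map_cons, List.prod_cons, eulerθ_θ_mul, ih, mul_smul_comm, List.length_cons]
    push_cast
    rw [add_smul, one_smul, add_comm]

theorem eulerθ_eq_of_antisymmetric_of_harmonic (hn : 1 ≤ n) {f : Lam n}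
    (hanti : IsAntisymmetric n f) (hharm : IsHarmonic n f)
    (hvars : f ∈ Algebra.adjoin ℚ (Set.range (θ n))) :
    eulerθ n f = ((n - 1 : ℕ) : ℚ) • f := by
  have hD : ∑ i, dθ n i f = 0 := by
    simpa [D] using hharm 1 0 0 le_rfl zero_le_one zero_le_one one_pos
  set g := f - ∑ i, killθ n i f with hg
  have hkill (j : Fin n) : killθ n j g = 0 := by
    rw [hg, map_sub, map_sum, Finset.sum_eq_single j, sub_eq_zero]
    · simp only [killθ_apply, map_sub, dθ_θ_mul, mul_sub, θ_mul_θ_mul_self]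
      simp
    · exact fun i _ hij => killθ_killθ_eq_zero hanti hvars hij
    · simp
  have hθg (j : Fin n) : θ n j * g = 0 := by
    have h := congrArg (θ n j * ·) (hkill j)
    simpa [killθ_apply, mul_sub, θ_mul_θ_mul_self] using h
  have hg' : g = f - (n : ℚ) • f + eulerθ n f := by
    rw [hg, eulerθ_apply]
    simp only [killθ_apply, Finset.sum_sub_distrib, Finset.sum_const, Finset.card_univ,
      Fintype.card_fin, Nat.cast_smul_eq_nsmul]
    abel
  have hDE : ∑ j, dθ n j (eulerθ n f) = 0 := by
    simp only [eulerθ_apply, map_sum, dθ_θ_mul]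
    rw [Finset.sum_comm]
    have h (i : Fin n) : ∑ j, dθ n j (dθ n i f) = 0 := by
      rw [Finset.sum_congr rfl fun j _ => dθ_dθ_comm j i f, Finset.sum_neg_distrib, ← map_sum, hD,
        map_zero, neg_zero]
    simp [Finset.sum_sub_distrib, ← Finset.mul_sum, h, hD]
  have hDg : ∑ j, dθ n j g = 0 := by
    simp only [hg', map_add, map_sub, map_smul, Finset.sum_add_distrib, Finset.sum_sub_distrib,
      ← Finset.smul_sum, hD, hDE]
    simp
  have hg0 : g = 0 := by
    have i₀ : Fin n := ⟨0, hn⟩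
    have h (j : Fin n) : θ n i₀ * dθ n j g = if j = i₀ then g else 0 := by
      have := dθ_θ_mul j i₀ g
      rw [hθg, map_zero] at this
      exact (sub_eq_zero.mp this.symm).symm
    have h' := congrArg (θ n i₀ * ·) hDg
    simpa [Finset.mul_sum, h] using h'
  rw [hg0] at hg'
  rw [Nat.cast_sub hn, sub_smul, Nat.cast_one, one_smul, ← sub_eq_zero, hg']
  abel

theorem prod_θ_eq_ιMulti {a : ℕ} (p : Fin a → Fin n) :
    (List.ofFn fun i => θ n (p i)).prod = ExteriorAlgebra.ιMulti ℚ a (fun i => e n 0 (p i)) := by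
  rw [ExteriorAlgebra.ιMulti_apply]
  rfl

theorem prod_θ_eq_zero {a : ℕ} {p : Fin a → Fin n} (hp : ¬ Function.Injective p) :
    (List.ofFn fun i => θ n (p i)).prod = 0 := by
  rw [prod_θ_eq_ιMulti]
  exact AlternatingMap.map_eq_zero_of_not_injective _ _
    fun h => hp (Function.Injective.of_comp (f := e n 0) h)

theorem prod_θ_mem_lamGrade {a : ℕ} (p : Fin a → Fin n) :
    (List.ofFn fun i => θ n (p i)).prod ∈ lamGrade n a 0 0 := by
  by_cases hp : Function.Injective p
  · have hmem : (List.ofFn fun i => θ n ((p ∘ Tuple.sort p) i)).prod ∈ lamGrade n a 0 0 :=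
      Submodule.subset_span ⟨p ∘ Tuple.sort p, Fin.elim0, Fin.elim0,
        (Tuple.monotone_sort p).strictMono_of_injective (hp.comp (Tuple.sort p).injective),
        fun i => i.elim0, fun i => i.elim0, by simp⟩
    rw [prod_θ_eq_ιMulti] at hmem ⊢
    have hperm := AlternatingMap.map_perm (ExteriorAlgebra.ιMulti ℚ a)
      (fun i => e n 0 (p i)) (Tuple.sort p)
    have hmem' : Equiv.Perm.sign (Tuple.sort p) •
        ExteriorAlgebra.ιMulti ℚ a (fun i => e n 0 (p i)) ∈ lamGrade n a 0 0 := by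
      rw [← hperm]; exact hmem
    rcases Int.units_eq_one_or (Equiv.Perm.sign (Tuple.sort p)) with h | h
    · simpa [h] using hmem'
    · simpa [h, Units.smul_def] using hmem'
  · rw [prod_θ_eq_zero hp]
    exact zero_mem _

/-- The `θ`-only elements on which the Euler operator acts by `d ≤ n` are homogeneous. -/
theorem mem_lamGrade_of_eulerθ_eq {d : ℕ} (hd : d ≤ n) {f : Lam n}
    (hvars : f ∈ Algebra.adjoin ℚ (Set.range (θ n))) (hf : eulerθ n f = (d : ℚ) • f) :
    f ∈ lamGrade n d 0 0 := by
  set L : Polynomial ℚ := Lagrange.basis (Finset.range (n + 1)) (fun k : ℕ => (k : ℚ)) d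
  have hinj : Set.InjOn (fun k : ℕ => (k : ℚ)) (Finset.range (n + 1)) :=
    Nat.cast_injective.injOn
  have haeval {x : Lam n} {c : ℚ} (h : eulerθ n x = c • x) :
      Polynomial.aeval (eulerθ n) L x = L.eval c • x :=
    Module.End.aeval_apply_of_mem_apply_eq_smul h
  have hmap : Subalgebra.toSubmodule (Algebra.adjoin ℚ (Set.range (θ n))) ≤
      (lamGrade n d 0 0).comap (Polynomial.aeval (eulerθ n) L) := by
    rw [Algebra.adjoin_eq_span, Submodule.span_le]
    intro x hx
    obtain ⟨l, hl, rfl⟩ := Submonoid.exists_list_of_mem_closure hx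
    obtain ⟨l, rfl⟩ : l ∈ Set.range (List.map (θ n)) := by
      rw [Set.range_list_map]
      exact hl
    have hprod : (l.map (θ n)).prod = (List.ofFn fun i => θ n (l.get i)).prod := by
      conv_lhs => rw [← List.ofFn_get l, List.map_ofFn]
      rfl
    rw [SetLike.mem_coe, Submodule.mem_comap, haeval (eulerθ_prod l)]
    by_cases hld : l.length = d
    · subst hld
      rw [hprod]
      exact Submodule.smul_mem _ _ (prod_θ_mem_lamGrade _)
    by_cases hln : l.length ≤ n
    · have h0 : L.eval (l.length : ℚ) = 0 :=
        Lagrange.eval_basis_of_ne (v := fun k : ℕ => (k : ℚ)) (Ne.symm hld)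
          (Finset.mem_range.mpr (by omega))
      rw [h0, zero_smul]
      exact zero_mem _
    · rw [hprod, prod_θ_eq_zero, smul_zero]
      · exact zero_mem _
      · intro h
        exact hln (by simpa using Fintype.card_le_of_injective _ h)
  have h1 : L.eval (d : ℚ) = 1 :=
    Lagrange.eval_basis_self (v := fun k : ℕ => (k : ℚ)) hinj (Finset.mem_range.mpr (by omega))
  have := hmap hvars
  rwa [Submodule.mem_comap, haeval hf, h1, one_smul] at this

end Helpers

/-- A nonzero antisymmetric harmonic element of `Λ` involving only the θ-variables is
homogeneous of degree exactly `n - 1` in the θ-variables. -/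
theorem antisym_harmonic_theta_deg (n : ℕ) (hn : 1 ≤ n) (f : Lam n)
    (hanti : IsAntisymmetric n f) (hharm : IsHarmonic n f)
    (hvars : f ∈ Algebra.adjoin ℚ (Set.range (θ n))) (hf : f ≠ 0) :
    f ∈ lamGrade n (n - 1) 0 0 := by
  exact mem_lamGrade_of_eulerθ_eq (Nat.sub_le n 1) hvars
    (eulerθ_eq_of_antisymmetric_of_harmonic hn hanti hharm hvars)
end
end

section
/- Let n ≥ 1 and let f ∈ Λ be antisymmetric, harmonic, and lie in the ℚ-subalgebra of Λ generated by θ_1,…,θ_n, ξ_1,…,ξ_n (i.e., f involves only the θ- and ξ-variables). If f ≠ 0, then f is homogeneous of total degree exactly n−1; that is, f lies in the sum of the components Λ_{a,b,0} over all a, b with a+b = n−1. -/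
noncomputable section

open ExteriorAlgebra

section WedgeContract

variable {R M : Type*} [CommRing R] [AddCommGroup M] [Module R M]

/-- The operator `x ↦ v ∧ (φ ⌋ x)` on the exterior algebra. -/
def wedgeContract (φ : Module.Dual R M) (v : M) : Module.End R (ExteriorAlgebra R M) :=
  LinearMap.mulLeft R (ι R v) ∘ₗ CliffordAlgebra.contractLeft φ

theorem wedgeContract_apply (φ : Module.Dual R M) (v : M) (x : ExteriorAlgebra R M) :
    wedgeContract φ v x = ι R v * CliffordAlgebra.contractLeft φ x := rfl

theorem contractLeft_ι_mul_exterior (φ : Module.Dual R M) (v : M) (x : ExteriorAlgebra R M) :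
    CliffordAlgebra.contractLeft φ (ι R v * x) =
      φ v • x - ι R v * CliffordAlgebra.contractLeft φ x :=
  CliffordAlgebra.contractLeft_ι_mul φ v x

theorem ι_mul_ι_swap_mul (v w : M) (x : ExteriorAlgebra R M) :
    ι R v * (ι R w * x) = -(ι R w * (ι R v * x)) := by
  rw [← mul_assoc, ← mul_assoc, ← neg_mul, eq_neg_of_add_eq_zero_left (ι_add_mul_swap v w)]

theorem ι_mul_ι_self_mul (v : M) (x : ExteriorAlgebra R M) : ι R v * (ι R v * x) = 0 := by
  rw [← mul_assoc, ι_sq_zero, zero_mul]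

/-- A rank-one perturbation of the identity induces `1 - v ∧ (φ ⌋ ·)` on the exterior algebra. -/
theorem map_id_sub_smulRight (φ : Module.Dual R M) (v : M) (x : ExteriorAlgebra R M) :
    ExteriorAlgebra.map (LinearMap.id - φ.smulRight v) x = x - wedgeContract φ v x := by
  rw [wedgeContract_apply]
  induction x using CliffordAlgebra.left_induction with
  | algebraMap r => rw [CliffordAlgebra.contractLeft_algebraMap, mul_zero, sub_zero]; simp
  | add x y hx hy => rw [map_add, hx, hy, map_add, mul_add]; abel
  | ι_mul x m hx =>
    change ExteriorAlgebra.map _ (ι R m * x) =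
      ι R m * x - ι R v * CliffordAlgebra.contractLeft φ (ι R m * x)
    rw [map_mul, hx, contractLeft_ι_mul_exterior, map_apply_ι]
    simp only [LinearMap.sub_apply, LinearMap.id_apply, LinearMap.smulRight_apply, map_sub,
      map_smul, sub_mul, mul_sub, smul_mul_assoc, mul_smul_comm, ι_mul_ι_self_mul, smul_zero]
    rw [ι_mul_ι_swap_mul m v]
    abel

theorem wedgeContract_mul_self (φ : Module.Dual R M) (v : M) :
    wedgeContract φ v * wedgeContract φ v = φ v • wedgeContract φ v := by
  refine LinearMap.ext fun x => ?_
  simp only [Module.End.mul_apply, wedgeContract_apply, contractLeft_ι_mul_exterior, mul_sub,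
    ι_mul_ι_self_mul, sub_zero, mul_smul_comm, LinearMap.smul_apply]

end WedgeContract

/-- The coordinate functional dual to `e n j i`. -/
def coord (n : ℕ) (j : Fin 3) (i : Fin n) : Module.Dual ℚ (V n) := LinearMap.proj (j, i)

@[simp]
theorem coord_apply (n : ℕ) (j : Fin 3) (i : Fin n) (v : V n) : coord n j i v = v (j, i) := rfl

/-- The Euler (total degree) operator. -/
def euler (n : ℕ) : Module.End ℚ (Lam n) :=
  ∑ p : Fin 3 × Fin n, wedgeContract (coord n p.1 p.2) (e n p.1 p.2)

theorem sum_smul_e (n : ℕ) (v : V n) : ∑ p : Fin 3 × Fin n, v p • e n p.1 p.2 = v := by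
  ext q
  simp [e, Finset.sum_apply, Pi.single_apply]

theorem euler_ι_mul (n : ℕ) (v : V n) (x : Lam n) :
    euler n (ι ℚ v * x) = ι ℚ v * x + ι ℚ v * euler n x := by
  have hterm (p : Fin 3 × Fin n) : wedgeContract (coord n p.1 p.2) (e n p.1 p.2) (ι ℚ v * x) =
      ι ℚ (v p • e n p.1 p.2) * x +
        ι ℚ v * wedgeContract (coord n p.1 p.2) (e n p.1 p.2) x := by
    rw [wedgeContract_apply, wedgeContract_apply, contractLeft_ι_mul_exterior, mul_sub,
      ι_mul_ι_swap_mul _ v, sub_neg_eq_add, mul_smul_comm, map_smul, smul_mul_assoc]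
    rfl
  simp only [euler, LinearMap.sum_apply, hterm, Finset.sum_add_distrib]
  rw [← Finset.sum_mul, ← map_sum, sum_smul_e, Finset.mul_sum]

theorem euler_one (n : ℕ) : euler n 1 = 0 := by
  simp [euler, wedgeContract_apply, CliffordAlgebra.contractLeft_one]

theorem euler_list_prod_mul (n : ℕ) (l : List (V n)) {x : Lam n} {d : ℕ}
    (hx : euler n x = (d : ℚ) • x) :
    euler n ((l.map (ι ℚ)).prod * x) =
      ((l.length + d : ℕ) : ℚ) • ((l.map (ι ℚ)).prod * x) := by
  induction l with
  | nil => simpa using hx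
  | cons v l ih =>
    rw [List.map_cons, List.prod_cons, mul_assoc, euler_ι_mul, ih, mul_smul_comm,
      List.length_cons]
    push_cast
    module

theorem lamGrade_le_eigenspace (n a b : ℕ) :
    lamGrade n a b 0 ≤ (euler n).eigenspace ((a + b : ℕ) : ℚ) := by
  refine Submodule.span_le.2 ?_
  rintro _ ⟨p, q, r, -, -, -, rfl⟩
  have key := euler_list_prod_mul n (List.ofFn fun i => e n 0 (p i))
    (euler_list_prod_mul n (List.ofFn fun i => e n 1 (q i)) (x := 1) (d := 0)
      (by simp [euler_one]))
  simp only [List.map_ofFn, Function.comp_def, List.length_ofFn, mul_one, add_zero] at key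
  simpa [Module.End.mem_eigenspace_iff, θ, ξ] using key

/-- A product of variables of one family is, up to a scalar, a product with increasing indices. -/
theorem exists_strictMono_ιMulti (n : ℕ) (j : Fin 3) {a : ℕ} (p : Fin a → Fin n) :
    ιMulti ℚ a (fun i => e n j (p i)) = 0 ∨
      ∃ (p' : Fin a → Fin n) (c : ℚ), StrictMono p' ∧
        ιMulti ℚ a (fun i => e n j (p i)) = c • ιMulti ℚ a (fun i => e n j (p' i)) := by
  by_cases hp : Function.Injective p
  · right
    refine ⟨p ∘ Tuple.sort p, ((Equiv.Perm.sign (Tuple.sort p) : ℤ) : ℚ),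
      (Tuple.monotone_sort p).strictMono_of_injective (hp.comp (Tuple.sort p).injective), ?_⟩
    have h := (ιMulti ℚ a).map_perm (fun i => e n j (p i)) (Tuple.sort p)
    change ιMulti ℚ a (fun i => e n j ((p ∘ Tuple.sort p) i)) = _ at h
    rw [h, Units.smul_def, ← Int.cast_smul_eq_zsmul ℚ, smul_smul, ← Int.cast_mul, ← Units.val_mul,
      Int.units_mul_self]
    simp
  · left
    simp only [Function.Injective, not_forall] at hp
    obtain ⟨i, k, hik, hne⟩ := hp
    exact (ιMulti ℚ a).map_eq_zero_of_eq _ (by rw [hik]) hne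

theorem ιMulti_mul_ιMulti_mem_lamGrade (n : ℕ) {a b : ℕ} (p : Fin a → Fin n) (q : Fin b → Fin n) :
    ιMulti ℚ a (fun i => e n 0 (p i)) * ιMulti ℚ b (fun i => e n 1 (q i)) ∈
      lamGrade n a b 0 := by
  obtain hp | ⟨p', c, hp', hp⟩ := exists_strictMono_ιMulti n 0 p
  · simp [hp]
  obtain hq | ⟨q', d, hq', hq⟩ := exists_strictMono_ιMulti n 1 q
  · simp [hq]
  rw [hp, hq, smul_mul_smul_comm]
  refine Submodule.smul_mem _ _ (Submodule.subset_span
    ⟨p', q', Fin.elim0, hp', hq', fun i => i.elim0, ?_⟩)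
  simp [ιMulti_apply, θ, ξ]

theorem ι_mul_ιMulti (n : ℕ) (v : V n) {a : ℕ} (w : Fin a → V n) :
    ι ℚ v * ιMulti ℚ a w = (-1 : ℚ) ^ a • (ιMulti ℚ a w * ι ℚ v) := by
  induction a with
  | zero => simp
  | succ a ih =>
    rw [ιMulti_succ_apply, ι_mul_ι_swap_mul, ih, mul_smul_comm, mul_assoc, pow_succ]
    simp

/-- Every monomial in the `θ` and `ξ` is a scalar multiple of a product of `θ`s times a product
of `ξ`s. -/
theorem exists_eq_smul_ιMulti_mul_ιMulti (n : ℕ) {x : Lam n}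
    (hx : x ∈ Submonoid.closure (Set.range (θ n) ∪ Set.range (ξ n))) :
    ∃ (a b : ℕ) (p : Fin a → Fin n) (q : Fin b → Fin n) (c : ℚ),
      x = c • (ιMulti ℚ a (fun i => e n 0 (p i)) * ιMulti ℚ b (fun i => e n 1 (q i))) := by
  induction hx using Submonoid.closure_induction_left with
  | one => exact ⟨0, 0, Fin.elim0, Fin.elim0, 1, by simp⟩
  | mul_left x hx y _ ih =>
    obtain ⟨a, b, p, q, c, rfl⟩ := ih
    obtain ⟨i, rfl⟩ | ⟨i, rfl⟩ := hx
    · refine ⟨a + 1, b, Fin.cons i p, q, c, ?_⟩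
      rw [ιMulti_succ_apply, mul_smul_comm, mul_assoc]
      rfl
    · refine ⟨a, b + 1, p, Fin.cons i q, c * (-1) ^ a, ?_⟩
      rw [ιMulti_succ_apply, mul_smul_comm, ← mul_assoc, ξ, ι_mul_ιMulti, mul_smul, smul_mul_assoc,
        mul_assoc]
      rfl

theorem adjoin_le_iSup_lamGrade (n : ℕ) :
    Subalgebra.toSubmodule (Algebra.adjoin ℚ (Set.range (θ n) ∪ Set.range (ξ n))) ≤
      ⨆ (d : ℕ) (ab : ℕ × ℕ) (_ : ab.1 + ab.2 = d), lamGrade n ab.1 ab.2 0 := by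
  rw [Algebra.adjoin_eq_span, Submodule.span_le]
  intro x hx
  obtain ⟨a, b, p, q, c, rfl⟩ := exists_eq_smul_ιMulti_mul_ιMulti n hx
  refine Submodule.smul_mem _ _ ?_
  exact Submodule.mem_iSup_of_mem (a + b) <| Submodule.mem_iSup_of_mem (a, b) <|
    Submodule.mem_iSup_of_mem rfl (ιMulti_mul_ιMulti_mem_lamGrade n p q)

theorem dρ_eq_zero_of_mem_adjoin (n : ℕ) (i : Fin n) {f : Lam n}
    (hf : f ∈ Algebra.adjoin ℚ (Set.range (θ n) ∪ Set.range (ξ n))) : dρ n i f = 0 := by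
  suffices h : Subalgebra.toSubmodule (Algebra.adjoin ℚ (Set.range (θ n) ∪ Set.range (ξ n))) ≤
      LinearMap.ker (dρ n i) from h hf
  rw [Algebra.adjoin_eq_span, Submodule.span_le]
  intro x hx
  change dρ n i x = 0
  induction hx using Submonoid.closure_induction_left with
  | one => exact CliffordAlgebra.contractLeft_one (Q := 0) (coord n 2 i)
  | mul_left x hx y _ ih =>
    change CliffordAlgebra.contractLeft (coord n 2 i) _ = 0 at ih ⊢
    obtain ⟨k, rfl⟩ | ⟨k, rfl⟩ := hx
    · rw [θ, contractLeft_ι_mul_exterior, ih]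
      simp [e]
    · rw [ξ, contractLeft_ι_mul_exterior, ih]
      simp [e]

/-- The operator `x ↦ (v_i - v_k) ∧ ((v_i^* - v_k^*) ⌋ x)` for the `j`-th family of variables. -/
def rootOp (n : ℕ) (j : Fin 3) (i k : Fin n) : Module.End ℚ (Lam n) :=
  wedgeContract (coord n j i - coord n j k) (e n j i - e n j k)

theorem rootOp_mul_self (n : ℕ) (j : Fin 3) {i k : Fin n} (h : i ≠ k) :
    rootOp n j i k * rootOp n j i k = (2 : ℚ) • rootOp n j i k := by
  rw [rootOp, wedgeContract_mul_self]
  congr 1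
  simp [e, h, h.symm]
  norm_num

theorem A_swap (n : ℕ) {i k : Fin n} (h : i ≠ k) (f : Lam n) :
    A n (Equiv.swap i k) f =
      (1 - rootOp n 0 i k) ((1 - rootOp n 1 i k) ((1 - rootOp n 2 i k) f)) := by
  have hlin : (LinearMap.funLeft ℚ ℚ
      (fun p : Fin 3 × Fin n => (p.1, (Equiv.swap i k)⁻¹ p.2)) : V n →ₗ[ℚ] V n) =
      (LinearMap.id - (coord n 0 i - coord n 0 k).smulRight (e n 0 i - e n 0 k)) ∘ₗ
      (LinearMap.id - (coord n 1 i - coord n 1 k).smulRight (e n 1 i - e n 1 k)) ∘ₗ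
      (LinearMap.id - (coord n 2 i - coord n 2 k).smulRight (e n 2 i - e n 2 k)) := by
    refine LinearMap.ext fun v => funext fun ⟨j, m⟩ => ?_
    by_cases hi : m = i
    · subst hi
      fin_cases j <;> simp [LinearMap.funLeft_apply, e, h, h.symm]
    · by_cases hk : m = k
      · subst hk
        fin_cases j <;> simp [LinearMap.funLeft_apply, e, h, h.symm]
      · fin_cases j <;>
          simp [LinearMap.funLeft_apply, e, hi, hk,
            Equiv.swap_apply_of_ne_of_ne hi hk]
  rw [A, hlin, ← map_comp_map, ← map_comp_map, AlgHom.comp_apply, AlgHom.comp_apply,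
    map_id_sub_smulRight, map_id_sub_smulRight, map_id_sub_smulRight]
  rfl

/-- If `P² = 2P` and `(1 - P)(1 - Q) f = -f`, then `P f + Q f = 2 f`. -/
theorem add_apply_eq_two_smul {W : Type*} [AddCommGroup W] [Module ℚ W] {P Q : Module.End ℚ W}
    (hP : P * P = (2 : ℚ) • P) {f : W} (hf : (1 - P) ((1 - Q) f) = -f) :
    P f + Q f = (2 : ℚ) • f := by
  have hPP (x : W) : P (P x) = (2 : ℚ) • P x := LinearMap.congr_fun hP x
  have h1 : P f + Q f = (2 : ℚ) • f + P (Q f) := by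
    simp only [LinearMap.sub_apply, Module.End.one_apply, map_sub] at hf
    rw [← sub_eq_zero] at hf ⊢
    rw [← neg_eq_zero, ← hf]
    module
  have h2 := congrArg P h1
  simp only [map_add, map_smul, hPP] at h2
  have h3 : P (Q f) = 0 := by
    rw [← sub_eq_zero] at h2
    rw [← neg_eq_zero, ← h2]
    module
  rw [h1, h3, add_zero]

theorem rootOp_add_rootOp (n : ℕ) {f : Lam n} (hanti : IsAntisymmetric n f)
    (hvars : f ∈ Algebra.adjoin ℚ (Set.range (θ n) ∪ Set.range (ξ n))) {i k : Fin n}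
    (h : i ≠ k) : rootOp n 0 i k f + rootOp n 1 i k f = (2 : ℚ) • f := by
  have hρ : rootOp n 2 i k f = 0 := by
    have hi := dρ_eq_zero_of_mem_adjoin n i hvars
    have hk := dρ_eq_zero_of_mem_adjoin n k hvars
    change CliffordAlgebra.contractLeft (coord n 2 _) f = 0 at hi hk
    rw [rootOp, wedgeContract_apply, map_sub CliffordAlgebra.contractLeft, LinearMap.sub_apply, hi,
      hk, sub_zero, mul_zero]
  refine add_apply_eq_two_smul (rootOp_mul_self n 0 h) ?_
  have hA := A_swap n h f
  rw [hanti, Equiv.Perm.sign_swap h, LinearMap.sub_apply 1 (rootOp n 2 i k), hρ] at hA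
  simpa using hA.symm

/-- Summing the root operators over all pairs gives a multiple of the degree operator of one
family, on elements killed by the total derivative of that family. -/
theorem sum_rootOp (n : ℕ) (j : Fin 3) {f : Lam n}
    (hf : ∑ i, CliffordAlgebra.contractLeft (coord n j i) f = 0) :
    ∑ i, ∑ k, rootOp n j i k f =
      (2 * n : ℚ) • ∑ i, wedgeContract (coord n j i) (e n j i) f := by
  have hterm (i k : Fin n) : rootOp n j i k f =
      (wedgeContract (coord n j i) (e n j i) f + wedgeContract (coord n j k) (e n j k) f) -
        (ι ℚ (e n j i) * CliffordAlgebra.contractLeft (coord n j k) f +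
          ι ℚ (e n j k) * CliffordAlgebra.contractLeft (coord n j i) f) := by
    simp only [rootOp, wedgeContract_apply, map_sub, LinearMap.sub_apply, sub_mul, mul_sub]
    abel
  simp only [hterm, Finset.sum_sub_distrib, Finset.sum_add_distrib, ← Finset.mul_sum,
    ← Finset.sum_mul, hf, mul_zero, Finset.sum_const_zero, add_zero, sub_zero, Finset.sum_const,
    Finset.card_univ, Fintype.card_fin, ← Nat.cast_smul_eq_nsmul ℚ, ← Finset.smul_sum]
  module

theorem euler_eq_smul (n : ℕ) (hn : 1 ≤ n) {f : Lam n} (hanti : IsAntisymmetric n f)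
    (hharm : IsHarmonic n f)
    (hvars : f ∈ Algebra.adjoin ℚ (Set.range (θ n) ∪ Set.range (ξ n))) :
    euler n f = ((n - 1 : ℕ) : ℚ) • f := by
  have h0 := hharm 1 0 0 (by simp) (by simp) (by simp) (by simp)
  have h1 := hharm 0 1 0 (by simp) (by simp) (by simp) (by simp)
  simp only [D, pow_one, pow_zero, mul_one, one_mul, LinearMap.sum_apply] at h0 h1
  have hpair (i k : Fin n) : rootOp n 0 i k f + rootOp n 1 i k f =
      (2 : ℚ) • f - if i = k then (2 : ℚ) • f else 0 := by
    split_ifs with h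
    · subst h
      simp [rootOp, wedgeContract_apply]
    · rw [rootOp_add_rootOp n hanti hvars h, sub_zero]
  have hsum : ∑ i, ∑ k, (rootOp n 0 i k f + rootOp n 1 i k f) =
      (2 * n * (n - 1) : ℚ) • f := by
    simp only [hpair, Finset.sum_sub_distrib, Finset.sum_const, Finset.sum_ite_eq,
      Finset.mem_univ, if_true, Finset.card_univ, Fintype.card_fin, ← Nat.cast_smul_eq_nsmul ℚ]
    module
  simp only [Finset.sum_add_distrib, sum_rootOp n 0 h0, sum_rootOp n 1 h1] at hsum
  have heuler : euler n f = ∑ i, wedgeContract (coord n 0 i) (e n 0 i) f +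
      ∑ i, wedgeContract (coord n 1 i) (e n 1 i) f := by
    have h2 (i : Fin n) : wedgeContract (coord n 2 i) (e n 2 i) f = 0 := by
      have := dρ_eq_zero_of_mem_adjoin n i hvars
      change CliffordAlgebra.contractLeft (coord n 2 i) f = 0 at this
      rw [wedgeContract_apply, this, mul_zero]
    rw [euler, LinearMap.sum_apply, Fintype.sum_prod_type, Fin.sum_univ_three]
    simp only [h2, Finset.sum_const_zero, add_zero]
  have hn0 : (2 * n : ℚ) ≠ 0 := by positivity
  rw [← smul_add, ← heuler, mul_smul (2 * n : ℚ) (n - 1 : ℚ)] at hsum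
  rw [Nat.cast_sub hn, Nat.cast_one]
  exact smul_right_injective (Lam n) hn0 hsum

theorem mem_of_mem_iSup_of_le_eigenspace {W : Type*} [AddCommGroup W] [Module ℚ W]
    {T : Module.End ℚ W} {G : ℕ → Submodule ℚ W} (hG : ∀ d : ℕ, G d ≤ T.eigenspace (d : ℚ))
    {m : ℕ} {f : W} (hf : f ∈ ⨆ d, G d) (hT : T f = (m : ℚ) • f) : f ∈ G m := by
  rw [iSup_split_single _ m] at hf
  obtain ⟨g, hg, h, hh, rfl⟩ := Submodule.mem_sup.1 hf
  have hle : ⨆ (d : ℕ) (_ : d ≠ m), G d ≤ ⨆ (μ : ℚ) (_ : μ ≠ (m : ℚ)), T.eigenspace μ :=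
    iSup₂_le fun d hd => (hG d).trans
      (le_iSup₂_of_le (d : ℚ) (Nat.cast_injective.ne hd) le_rfl)
  have heig : h ∈ T.eigenspace (m : ℚ) := by
    simpa using Submodule.sub_mem _ (Module.End.mem_eigenspace_iff.2 hT) (hG m hg)
  rwa [Submodule.disjoint_def.1 (T.eigenspaces_iSupIndep (m : ℚ)) h heig (hle hh), add_zero]

/-- A nonzero antisymmetric harmonic element of `Λ` involving only the θ- and ξ-variables
is homogeneous of total degree exactly `n - 1`. -/
theorem antisym_harmonic_theta_xi_deg (n : ℕ) (hn : 1 ≤ n) (f : Lam n)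
    (hanti : IsAntisymmetric n f) (hharm : IsHarmonic n f)
    (hvars : f ∈ Algebra.adjoin ℚ (Set.range (θ n) ∪ Set.range (ξ n))) (hf : f ≠ 0) :
    f ∈ ⨆ (ab : ℕ × ℕ) (_ : ab.1 + ab.2 = n - 1), lamGrade n ab.1 ab.2 0 := by
  exact mem_of_mem_iSup_of_le_eigenspace
    (G := fun d => ⨆ (ab : ℕ × ℕ) (_ : ab.1 + ab.2 = d), lamGrade n ab.1 ab.2 0)
    (fun d => iSup₂_le fun ab h => h ▸ lamGrade_le_eigenspace n ab.1 ab.2)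
    (adjoin_le_iSup_lamGrade n hvars) (euler_eq_smul n hn hanti hharm hvars)
end
end

section
/- For every n ≥ 1, the primary theta-seed Δ₁ := Σ_{σ} sgn(σ)·A_σ(θ_1 θ_2 ⋯ θ_{n−1}) (sum over all permutations σ of {1,…,n}; for n = 1 the product is the empty product 1) is harmonic: Σ_{i=1}^n ∂_{θ_i}^h ∂_{ξ_i}^k ∂_{ρ_i}^ℓ Δ₁ = 0 for every (h,k,ℓ) ∈ {0,1}³ with h+k+ℓ > 0. -/
noncomputable section

open ExteriorAlgebra

/-- The primary theta-seed `Δ₁ = Σ_σ sgn(σ) • A_σ(θ_1 θ_2 ⋯ θ_{n-1})`. -/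
def Δ₁ (n : ℕ) : Lam n :=
  ∑ σ : Equiv.Perm (Fin n), ((Equiv.Perm.sign σ : ℤ) : ℚ) •
    A n σ ((List.ofFn fun i : Fin (n - 1) => θ n (Fin.castLE (Nat.sub_le n 1) i)).prod)

/-- The total functional `∑ i, e*_{(0,i)}`, so that contraction with it is `∑ i, ∂_{θ_i}`. -/
def thetaSum (n : ℕ) : Module.Dual ℚ (V n) := ∑ i : Fin n, LinearMap.proj ((0 : Fin 3), i)

/-- The monomial `θ_{i₁} ⋯ θ_{iₘ}` attached to a list of indices. -/
def thetaProd (n : ℕ) (l : List (Fin n)) : Lam n := (l.map (θ n)).prod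

/-- The antisymmetrization operator `∑ σ, sgn(σ) • A_σ`. -/
def antisymmetrize (n : ℕ) : Module.End ℚ (Lam n) :=
  ∑ σ : Equiv.Perm (Fin n), ((Equiv.Perm.sign σ : ℤ) : ℚ) • (A n σ).toLinearMap

theorem antisymmetrize_apply (n : ℕ) (x : Lam n) :
    antisymmetrize n x = ∑ σ : Equiv.Perm (Fin n), ((Equiv.Perm.sign σ : ℤ) : ℚ) • A n σ x := by
  simp [antisymmetrize]

theorem A_theta (n : ℕ) (σ : Equiv.Perm (Fin n)) (i : Fin n) : A n σ (θ n i) = θ n (σ i) := by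
  rw [A, θ, θ, ExteriorAlgebra.map_apply_ι]
  congr 1
  ext ⟨j, k⟩
  simp [e, LinearMap.funLeft_apply, Pi.single_apply, Prod.ext_iff, Equiv.symm_apply_eq]

theorem A_thetaProd (n : ℕ) (σ : Equiv.Perm (Fin n)) (l : List (Fin n)) :
    A n σ (thetaProd n l) = thetaProd n (l.map σ) := by
  simp [thetaProd, map_list_prod, Function.comp_def, A_theta]

theorem A_mul_apply (n : ℕ) (σ τ : Equiv.Perm (Fin n)) (x : Lam n) :
    A n (σ * τ) x = A n σ (A n τ x) := by
  rw [← AlgHom.comp_apply]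
  congr 1
  rw [A, A, A, ExteriorAlgebra.map_comp_map]
  rfl

theorem thetaProd_cons (n : ℕ) (i : Fin n) (l : List (Fin n)) :
    thetaProd n (i :: l) = θ n i * thetaProd n l := by
  simp [thetaProd]

theorem contractLeft_theta_mul (n : ℕ) (d : Module.Dual ℚ (V n)) (i : Fin n) (x : Lam n) :
    CliffordAlgebra.contractLeft d (θ n i * x) =
      d (e n 0 i) • x - θ n i * CliffordAlgebra.contractLeft d x :=
  CliffordAlgebra.contractLeft_ι_mul _ _ _

theorem contractLeft_thetaProd_eq_zero (n : ℕ) (d : Module.Dual ℚ (V n))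
    (hd : ∀ i, d (e n 0 i) = 0) (l : List (Fin n)) :
    CliffordAlgebra.contractLeft d (thetaProd n l) = 0 := by
  induction l with
  | nil => exact CliffordAlgebra.contractLeft_one _ _
  | cons i l ih => rw [thetaProd_cons, contractLeft_theta_mul, ih, hd]; simp

theorem thetaSum_e (n : ℕ) (i : Fin n) : thetaSum n (e n 0 i) = 1 := by
  simp [thetaSum, e, Pi.single_apply]

/-- Contraction with the total functional commutes with the symmetric group action. -/
theorem contractLeft_thetaSum_A_thetaProd (n : ℕ) (σ : Equiv.Perm (Fin n)) (l : List (Fin n)) :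
    CliffordAlgebra.contractLeft (thetaSum n) (A n σ (thetaProd n l)) =
      A n σ (CliffordAlgebra.contractLeft (thetaSum n) (thetaProd n l)) := by
  induction l with
  | nil =>
    have h : CliffordAlgebra.contractLeft (thetaSum n) (1 : Lam n) = 0 :=
      CliffordAlgebra.contractLeft_one _ _
    simp [thetaProd, h]
  | cons i l ih =>
    rw [thetaProd_cons, map_mul, A_theta, contractLeft_theta_mul, contractLeft_theta_mul, ih,
      thetaSum_e, thetaSum_e, map_sub, map_mul, A_theta, map_smul]

theorem contractLeft_thetaProd_mem_span (n : ℕ) (d : Module.Dual ℚ (V n)) (l : List (Fin n)) :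
    CliffordAlgebra.contractLeft d (thetaProd n l) ∈
      Submodule.span ℚ (thetaProd n '' {l' | l'.length + 1 = l.length}) := by
  induction l with
  | nil =>
    have h : CliffordAlgebra.contractLeft d (thetaProd n []) = 0 :=
      CliffordAlgebra.contractLeft_one _ _
    rw [h]
    exact zero_mem _
  | cons i l ih =>
    rw [thetaProd_cons, contractLeft_theta_mul]
    refine sub_mem (Submodule.smul_mem _ _ (Submodule.subset_span ⟨l, by simp, rfl⟩)) ?_
    refine (Submodule.span_le (p := (Submodule.span ℚ (thetaProd n ''
      {l' | l'.length + 1 = (i :: l).length})).comap (LinearMap.mulLeft ℚ (θ n i)))).2 ?_ ih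
    rintro _ ⟨l', hl', rfl⟩
    refine Submodule.subset_span ⟨i :: l', ?_, thetaProd_cons n i l'⟩
    simpa using hl'

theorem antisymmetrize_A (n : ℕ) (τ : Equiv.Perm (Fin n)) (x : Lam n) :
    antisymmetrize n (A n τ x) = ((Equiv.Perm.sign τ : ℤ) : ℚ) • antisymmetrize n x := by
  rw [antisymmetrize_apply, antisymmetrize_apply, Finset.smul_sum,
    ← Equiv.sum_comp (Equiv.mulRight τ)
      fun σ => ((Equiv.Perm.sign τ : ℤ) : ℚ) • ((Equiv.Perm.sign σ : ℤ) : ℚ) • A n σ x]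
  refine Finset.sum_congr rfl fun σ _ => ?_
  rw [Equiv.coe_mulRight, A_mul_apply, smul_smul]
  congr 1
  rcases Int.units_eq_one_or (Equiv.Perm.sign τ) with h | h <;> simp [h]

/-- A theta monomial missing two indices has vanishing antisymmetrization. -/
theorem antisymmetrize_thetaProd_eq_zero (n : ℕ) (l : List (Fin n)) (hl : l.length + 2 ≤ n) :
    antisymmetrize n (thetaProd n l) = 0 := by
  have hcard : 1 < (l.toFinsetᶜ).card := by
    have := l.toFinset_card_le
    rw [Finset.card_compl, Fintype.card_fin]
    omega
  obtain ⟨a, ha, b, hb, hab⟩ := Finset.one_lt_card.1 hcard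
  simp only [Finset.mem_compl, List.mem_toFinset] at ha hb
  have hfix : l.map (Equiv.swap a b) = l := by
    conv_rhs => rw [← List.map_id l]
    refine List.map_congr_left fun c hc => ?_
    exact Equiv.swap_apply_of_ne_of_ne (by rintro rfl; exact ha hc) (by rintro rfl; exact hb hc)
  have h := antisymmetrize_A n (Equiv.swap a b) (thetaProd n l)
  rw [A_thetaProd, hfix, Equiv.Perm.sign_swap hab] at h
  have h2 : (2 : ℚ) • antisymmetrize n (thetaProd n l) = 0 := by
    rw [two_smul, ← eq_neg_iff_add_eq_zero]
    simpa using h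
  exact (smul_eq_zero.1 h2).resolve_left two_ne_zero

theorem delta_eq_antisymmetrize (n : ℕ) : ∃ l : List (Fin n), l.length = n - 1 ∧
    Δ₁ n = antisymmetrize n (thetaProd n l) := by
  refine ⟨List.ofFn fun i : Fin (n - 1) => Fin.castLE (Nat.sub_le n 1) i, by simp, ?_⟩
  rw [antisymmetrize_apply, Δ₁, thetaProd, List.map_ofFn]
  rfl

theorem contractLeft_antisymmetrize_eq_zero (n : ℕ) (d : Module.Dual ℚ (V n))
    (hd : ∀ i, d (e n 0 i) = 0) (l : List (Fin n)) :
    CliffordAlgebra.contractLeft d (antisymmetrize n (thetaProd n l)) = 0 := by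
  rw [antisymmetrize_apply, map_sum]
  refine Finset.sum_eq_zero fun σ _ => ?_
  rw [map_smul, A_thetaProd, contractLeft_thetaProd_eq_zero n d hd, smul_zero]

theorem contractLeft_thetaSum_antisymmetrize (n : ℕ) (l : List (Fin n)) :
    CliffordAlgebra.contractLeft (thetaSum n) (antisymmetrize n (thetaProd n l)) =
      antisymmetrize n (CliffordAlgebra.contractLeft (thetaSum n) (thetaProd n l)) := by
  rw [antisymmetrize_apply, antisymmetrize_apply, map_sum]
  refine Finset.sum_congr rfl fun σ _ => ?_
  rw [map_smul, contractLeft_thetaSum_A_thetaProd]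

/-- The primary theta-seed `Δ₁` is harmonic. -/
theorem primary_theta_seed_harmonic (n : ℕ) (hn : 1 ≤ n) : IsHarmonic n (Δ₁ n) := by
  obtain ⟨l, hl, hΔ⟩ := delta_eq_antisymmetrize n
  have hξ : ∀ i, dξ n i (Δ₁ n) = 0 := fun i => by
    rw [hΔ]
    exact contractLeft_antisymmetrize_eq_zero n _ (fun j => by simp [e]) l
  have hρ : ∀ i, dρ n i (Δ₁ n) = 0 := fun i => by
    rw [hΔ]
    exact contractLeft_antisymmetrize_eq_zero n _ (fun j => by simp [e]) l
  have hθ : ∑ i, dθ n i (Δ₁ n) = 0 := by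
    have hsum : ∑ i, dθ n i (Δ₁ n) = CliffordAlgebra.contractLeft (thetaSum n) (Δ₁ n) := by
      simp [thetaSum, dθ, map_sum]
    rw [hsum, hΔ, contractLeft_thetaSum_antisymmetrize]
    refine (Submodule.span_le (p := LinearMap.ker (antisymmetrize n))).2 ?_
      (contractLeft_thetaProd_mem_span n (thetaSum n) l)
    rintro _ ⟨l', hl', rfl⟩
    rw [Set.mem_ofPred_eq] at hl'
    exact antisymmetrize_thetaProd_eq_zero n l' (by omega)
  intro h k m hh hk hm hpos
  rw [D, LinearMap.sum_apply]
  interval_cases m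
  · interval_cases k
    · obtain rfl : h = 1 := by omega
      simpa using hθ
    · simp [hξ]
  · simp [hρ]
end
end

section
/- For every n ≥ 3, the secondary theta-seed Δ₂ := Σ_{σ} sgn(σ)·A_σ((θ_1 ξ_2 ρ_2 + θ_2 ξ_1 ρ_2 + θ_2 ξ_2 ρ_1)·θ_3 θ_4 ⋯ θ_{n−1}) (sum over all permutations σ of {1,…,n}) is a nonzero element of Λ; in fact, antisymmetrization produces (n−2)! copies of the monomial θ_1 ξ_2 ρ_2 θ_3 θ_4 ⋯ θ_{n−1}. -/
noncomputable section

open ExteriorAlgebra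

/-- The secondary theta-seed
`Δ₂ = Σ_σ sgn(σ) • A_σ((θ_1 ξ_2 ρ_2 + θ_2 ξ_1 ρ_2 + θ_2 ξ_2 ρ_1) θ_3 θ_4 ⋯ θ_{n-1})`. -/
def Δ₂ (n : ℕ) (hn : 3 ≤ n) : Lam n :=
  ∑ σ : Equiv.Perm (Fin n), ((Equiv.Perm.sign σ : ℤ) : ℚ) •
    A n σ ((θ n ⟨0, by omega⟩ * ξ n ⟨1, by omega⟩ * ρ n ⟨1, by omega⟩ +
            θ n ⟨1, by omega⟩ * ξ n ⟨0, by omega⟩ * ρ n ⟨1, by omega⟩ +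
            θ n ⟨1, by omega⟩ * ξ n ⟨1, by omega⟩ * ρ n ⟨0, by omega⟩) *
           (List.ofFn fun i : Fin (n - 3) =>
             θ n ⟨(i : ℕ) + 2, by have := i.isLt; omega⟩).prod)

namespace ThetaSeed

/-- The monomial in the variables indexed by the word `w`. -/
def monomial {n : ℕ} (w : Fin n → Fin 3 × Fin n) : Lam n :=
  ιMulti ℚ n fun k => (Pi.single (w k) 1 : V n)

/-- The word `a, b, c, (0, 2), (0, 3), …, (0, m + 1)`. -/
def seedWord (m : ℕ) (a b c : Fin 3 × Fin (m + 3)) : Fin (m + 3) → Fin 3 × Fin (m + 3) :=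
  Fin.cons a (Fin.cons b (Fin.cons c fun i : Fin m => (0, ⟨i + 2, by omega⟩)))

lemma monomial_seedWord (m : ℕ) (a b c : Fin 3 × Fin (m + 3)) :
    monomial (seedWord m a b c) =
      ι ℚ (e (m + 3) a.1 a.2) * ι ℚ (e (m + 3) b.1 b.2) * ι ℚ (e (m + 3) c.1 c.2) *
        (List.ofFn fun i : Fin m => θ (m + 3) ⟨(i : ℕ) + 2, by omega⟩).prod := by
  simp only [monomial, ιMulti_apply, seedWord, List.ofFn_succ, Fin.cons_zero, Fin.cons_succ,
    List.prod_cons, mul_assoc, e, θ]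

lemma A_monomial {n : ℕ} (σ : Equiv.Perm (Fin n)) (w : Fin n → Fin 3 × Fin n) :
    A n σ (monomial w) = monomial fun k => ((w k).1, σ (w k).2) := by
  rw [A, monomial, map_apply_ιMulti, monomial]
  congr 1
  ext k p
  simp only [Function.comp_apply, LinearMap.funLeft_apply, Pi.single_apply]
  congr 1
  simp [Prod.ext_iff, Equiv.symm_apply_eq]

/-- The linear functional on `Λ` sending a monomial of degree `n` to its determinant in the
coordinates selected by `s`, and vanishing in all other degrees. -/
def coordDet {n : ℕ} (s : Fin n → Fin 3 × Fin n) : Lam n →ₗ[ℚ] ℚ :=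
  liftAlternating (Pi.single n
    ((Matrix.detRowAlternating (R := ℚ) (n := Fin n)).compLinearMap (LinearMap.funLeft ℚ ℚ s)))

lemma coordDet_monomial {n : ℕ} (s w : Fin n → Fin 3 × Fin n) :
    coordDet s (monomial w) =
      Matrix.det (Matrix.of fun k l => if s l = w k then (1 : ℚ) else 0) := by
  rw [coordDet, monomial, liftAlternating_apply_ιMulti, Pi.single_eq_same]
  change Matrix.det _ = _
  congr 1
  ext k l
  simp [Pi.single_apply, LinearMap.funLeft_apply]

lemma coordDet_monomial_of_notMem {n : ℕ} {s w : Fin n → Fin 3 × Fin n} (k : Fin n)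
    (hk : ∀ l, s l ≠ w k) : coordDet s (monomial w) = 0 := by
  rw [coordDet_monomial]
  exact Matrix.det_eq_zero_of_row_eq_zero k fun l => by simp [hk l]

lemma coordDet_monomial_comp_perm {n : ℕ} {s : Fin n → Fin 3 × Fin n}
    (hs : Function.Injective s) (π : Equiv.Perm (Fin n)) :
    coordDet s (monomial (s ∘ π)) = ((Equiv.Perm.sign π : ℤ) : ℚ) := by
  rw [coordDet_monomial, ← Matrix.det_permutation]
  congr 1
  ext k l
  simp [hs.eq_iff, PEquiv.toMatrix_apply, eq_comm]

/-- The variables `θ_0, ξ_1, θ_2, …, θ_{m+1}, ρ_1` of the leading monomial. -/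
def leadingVars (m : ℕ) (k : Fin (m + 3)) : Fin 3 × Fin (m + 3) :=
  if k = 1 then (1, 1) else if k = Fin.last _ then (2, 1) else (0, k)

lemma one_ne_last (m : ℕ) : (1 : Fin (m + 3)) ≠ Fin.last (m + 2) := by
  simp [Fin.ext_iff]

lemma leadingVars_injective (m : ℕ) : Function.Injective (leadingVars m) := by
  intro k l h
  unfold leadingVars at h
  split_ifs at h <;> simp_all

lemma leadingVars_of_fst_eq_zero {m : ℕ} {l i : Fin (m + 3)}
    (h : leadingVars m l = (0, i)) : i ≠ Fin.last _ := by
  unfold leadingVars at h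
  split_ifs at h <;> simp_all

lemma leadingVars_of_fst_ne_zero {m : ℕ} {l i : Fin (m + 3)} {j : Fin 3} (hj : j ≠ 0)
    (h : leadingVars m l = (j, i)) : i = 1 := by
  unfold leadingVars at h
  split_ifs at h <;> simp_all

/-- The order in which the leading monomial of the seed lists `leadingVars`. -/
def leadingOrder (m : ℕ) : Equiv.Perm (Fin (m + 3)) :=
  Equiv.ofBijective
    (fun k => if k.val ≤ 1 then k else if k.val = 2 then Fin.last _ else ⟨k - 1, by omega⟩)
    (Finite.injective_iff_bijective.1 fun k l h => by
      ext
      split_ifs at h <;> simp [Fin.ext_iff] at h <;> omega)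

lemma leadingVars_comp_leadingOrder (m : ℕ) :
    leadingVars m ∘ leadingOrder m = seedWord m (0, 0) (1, 1) (2, 1) := by
  funext k
  refine Fin.cases ?_ (fun k => Fin.cases ?_ (fun k => Fin.cases ?_ (fun k => ?_) k) k) k
  · simp [leadingOrder, leadingVars, seedWord, Fin.ext_iff]
  · simp [leadingOrder, leadingVars, seedWord]
  · have h2 : ((Fin.succ (Fin.succ 0) : Fin (m + 3)) : ℕ) = 2 := rfl
    simp only [leadingOrder, leadingVars, seedWord, Function.comp_apply, Equiv.ofBijective_apply,
      Fin.cons_succ, Fin.cons_zero, h2]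
    simp [(one_ne_last m).symm]
  · have := k.isLt
    simp [leadingOrder, leadingVars, seedWord, Fin.ext_iff]
    omega

lemma leadingVars_perm {m : ℕ} {σ : Equiv.Perm (Fin (m + 3))} (h₁ : σ 1 = 1)
    (hl : σ (Fin.last _) = Fin.last _) (k : Fin (m + 3)) :
    ((leadingVars m k).1, σ (leadingVars m k).2) = leadingVars m (σ k) := by
  have e₁ : σ k = 1 ↔ k = 1 := by rw [← σ.injective.eq_iff (a := k), h₁]
  have e₂ : σ k = Fin.last _ ↔ k = Fin.last _ := by rw [← σ.injective.eq_iff (a := k), hl]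
  simp only [leadingVars, e₁, e₂]
  split_ifs <;> simp [h₁]

lemma coordDet_A_leading (m : ℕ) (σ : Equiv.Perm (Fin (m + 3))) :
    coordDet (leadingVars m) (A _ σ (monomial (seedWord m (0, 0) (1, 1) (2, 1)))) =
      if σ 1 = 1 ∧ σ (Fin.last _) = Fin.last _ then
        ((Equiv.Perm.sign σ : ℤ) : ℚ) * ((Equiv.Perm.sign (leadingOrder m) : ℤ) : ℚ) else 0 := by
  rw [A_monomial]
  split_ifs with h
  · have hw : (fun k => ((seedWord m (0, 0) (1, 1) (2, 1) k).1,
        σ (seedWord m (0, 0) (1, 1) (2, 1) k).2)) = leadingVars m ∘ (σ * leadingOrder m) := by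
      funext k
      rw [← leadingVars_comp_leadingOrder]
      exact leadingVars_perm h.1 h.2 _
    rw [hw, coordDet_monomial_comp_perm (leadingVars_injective m)]
    simp
  · by_cases h₁ : σ 1 = 1
    · have hl : σ (Fin.last _) ≠ Fin.last _ := fun hl => h ⟨h₁, hl⟩
      set p := σ.symm (Fin.last _) with hp
      have hσp : σ p = Fin.last _ := by simp [hp]
      have hp₁ : p ≠ 1 := fun hp₁ => one_ne_last m (by rw [← hσp, hp₁, h₁])
      have hpl : p ≠ Fin.last _ := fun hpl => hl (by rw [← hpl, hσp, hpl])
      refine coordDet_monomial_of_notMem ((leadingOrder m).symm p) fun l hl' => ?_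
      rw [← leadingVars_comp_leadingOrder] at hl'
      simp only [Function.comp_apply, Equiv.apply_symm_apply] at hl'
      have hv : leadingVars m p = (0, p) := by simp [leadingVars, hp₁, hpl]
      rw [hv] at hl'
      exact leadingVars_of_fst_eq_zero hl' hσp
    · exact coordDet_monomial_of_notMem 1 fun l hl =>
        h₁ (leadingVars_of_fst_ne_zero (j := 1) (by decide) hl)

/-- Monomials whose `ξ` and `ρ` indices differ do not contribute to the coefficient. -/
lemma coordDet_A_eq_zero (m : ℕ) (σ : Equiv.Perm (Fin (m + 3))) (a : Fin 3 × Fin (m + 3))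
    {i j : Fin (m + 3)} (hij : i ≠ j) :
    coordDet (leadingVars m) (A _ σ (monomial (seedWord m a (1, i) (2, j)))) = 0 := by
  rw [A_monomial]
  by_cases hi : σ i = 1
  · exact coordDet_monomial_of_notMem 2 fun l hl => hij (σ.injective
      (hi.trans (leadingVars_of_fst_ne_zero (j := 2) (by decide) hl).symm))
  · exact coordDet_monomial_of_notMem 1 fun l hl =>
      hi (leadingVars_of_fst_ne_zero (j := 1) (by decide) hl)

lemma Δ₂_eq_sum_monomial (m : ℕ) (hn : 3 ≤ m + 3) :
    Δ₂ (m + 3) hn = ∑ σ : Equiv.Perm (Fin (m + 3)), ((Equiv.Perm.sign σ : ℤ) : ℚ) •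
      A _ σ (monomial (seedWord m (0, 0) (1, 1) (2, 1)) +
        monomial (seedWord m (0, 1) (1, 0) (2, 1)) +
        monomial (seedWord m (0, 1) (1, 1) (2, 0))) := by
  simp only [Δ₂, monomial_seedWord, add_mul]
  rfl

lemma coordDet_Δ₂ (m : ℕ) (hn : 3 ≤ m + 3) :
    coordDet (leadingVars m) (Δ₂ (m + 3) hn) =
      (Finset.univ.filter fun σ : Equiv.Perm (Fin (m + 3)) =>
        σ 1 = 1 ∧ σ (Fin.last _) = Fin.last _).card *
        ((Equiv.Perm.sign (leadingOrder m) : ℤ) : ℚ) := by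
  have h01 : (0 : Fin (m + 3)) ≠ 1 := by simp
  rw [Δ₂_eq_sum_monomial, map_sum, ← nsmul_eq_mul, ← Finset.sum_const, Finset.sum_filter]
  refine Finset.sum_congr rfl fun σ _ => ?_
  rw [map_smul, map_add, map_add, map_add, map_add, coordDet_A_leading,
    coordDet_A_eq_zero m σ _ h01, coordDet_A_eq_zero m σ _ h01.symm, add_zero, add_zero,
    smul_eq_mul, mul_ite, mul_zero, ← mul_assoc]
  have hsq : ((Equiv.Perm.sign σ : ℤ) : ℚ) * ((Equiv.Perm.sign σ : ℤ) : ℚ) = 1 := by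
    rw [← Int.cast_mul, ← Units.val_mul, Int.units_mul_self]
    simp
  rw [hsq, one_mul]

end ThetaSeed

/-- The secondary theta-seed `Δ₂` is a nonzero element of `Λ`. -/
theorem secondary_theta_seed_nonzero (n : ℕ) (hn : 3 ≤ n) : Δ₂ n hn ≠ 0 := by
  obtain ⟨m, rfl⟩ := Nat.exists_eq_add_of_le' hn
  intro h
  have hD := ThetaSeed.coordDet_Δ₂ m hn
  rw [h, map_zero, eq_comm, mul_eq_zero] at hD
  rcases hD with hD | hD
  · rw [Nat.cast_eq_zero, Finset.card_eq_zero] at hD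
    exact Finset.notMem_empty (1 : Equiv.Perm (Fin (m + 3))) (hD ▸ by simp)
  · exact (Equiv.Perm.sign (ThetaSeed.leadingOrder m)).ne_zero (Int.cast_eq_zero.1 hD)
end
end
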